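/- arXiv:2105.12813 — 2 statements merged into one kernel-verified Lean document; each statement's English description precedes it below -/
import Mathlib

section
/- There exist a real number r with 0 < r < 1, a real number Λ with 0 < Λ < 1, and positive constants c and C such that for every pair of integers n, j with 1 ≤ j ≤ n the following hold: (i) if j/n ∈ [0, r] ∪ [1−r, 1], then a(n,j) ≤ C·√n·Λ^n·n^n; (ii) if j/n ∈ [r, 1−r], then a(n,j) ≤ C·φ(j/n)^n·n^n; and (iii) if j/n ∈ [r, 1−r], then a(n,j) ≥ (c/√n)·φ(j/n)^n·n^n. -/
/-- Stirling numbers of the second kind via the alternating-sum formula for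
surjections: `j! * S(n,j) = ∑_{i=0}^{j} (-1)^i C(j,i) (j-i)^n`. -/
noncomputable def stirling2 (n j : ℕ) : ℝ :=
  (1 / (Nat.factorial j : ℝ)) *
    ∑ i ∈ Finset.range (j + 1), (-1 : ℝ) ^ i * (Nat.choose j i : ℝ) * ((j - i : ℕ) : ℝ) ^ n

/-- `a(n,j) = C(n,j) · j! · S(n,j)`, the number of words of length `n` over an
alphabet of `n` symbols using exactly `j` distinct symbols. -/
noncomputable def a (n j : ℕ) : ℝ :=
  (Nat.choose n j : ℝ) * (Nat.factorial j : ℝ) * stirling2 n j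

/-- `varphi(x) = x^(-x) (1-x)^(-(1-x))` (with the `rpow` conventions giving
`varphi 0 = varphi 1 = 1`). -/
noncomputable def varphi (x : ℝ) : ℝ := x ^ (-x) * (1 - x) ^ (-(1 - x))

/-- `φ(x) = (e · ln(1+e^{-δ(x)}))⁻¹ · varphi(x) · e^{-x·δ(x)}`, for a given `δ`. -/
noncomputable def phi (δ : ℝ → ℝ) (x : ℝ) : ℝ :=
  (Real.exp 1 * Real.log (1 + Real.exp (-(δ x))))⁻¹ * varphi x * Real.exp (-(x * δ x))

open Finset

/-- The coefficient of `y ^ k` in `(exp y - 1) ^ j`. -/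
noncomputable def surjCoeff (k j : ℕ) : ℝ :=
  (j.factorial : ℝ) * (Nat.stirlingSecond k j : ℝ) / (k.factorial : ℝ)

theorem surjection_sum_succ (k j : ℕ) :
    ∑ i ∈ range (j + 1 + 1), (-1 : ℝ) ^ i * (Nat.choose (j + 1) i : ℝ) *
        ((j + 1 - i : ℕ) : ℝ) ^ (k + 1) =
      (j + 1) * (∑ i ∈ range (j + 1 + 1), (-1 : ℝ) ^ i * (Nat.choose (j + 1) i : ℝ) *
          ((j + 1 - i : ℕ) : ℝ) ^ k +
        ∑ i ∈ range (j + 1), (-1 : ℝ) ^ i * (Nat.choose j i : ℝ) * ((j - i : ℕ) : ℝ) ^ k) := by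
  have h1 : ∑ i ∈ range (j + 1 + 1), (-1 : ℝ) ^ i * (Nat.choose (j + 1) i : ℝ) *
          ((j + 1 - i : ℕ) : ℝ) ^ k +
        ∑ i ∈ range (j + 1), (-1 : ℝ) ^ i * (Nat.choose j i : ℝ) * ((j - i : ℕ) : ℝ) ^ k =
      ∑ i ∈ range (j + 1 + 1), (-1 : ℝ) ^ i * (Nat.choose j i : ℝ) *
          ((j + 1 - i : ℕ) : ℝ) ^ k := by
    rw [sum_range_succ', sum_range_succ' _ (j + 1), add_right_comm, ← sum_add_distrib]
    congr 1
    · refine sum_congr rfl fun i _ => ?_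
      rw [Nat.choose_succ_succ, Nat.add_sub_add_right]
      push_cast
      ring
    · simp
  rw [h1, mul_sum]
  refine sum_congr rfl fun i hi => ?_
  have hi' : i ≤ j + 1 := by simpa [Nat.lt_succ_iff] using hi
  have h2 : ((j + 1 - i : ℕ) : ℝ) * (Nat.choose (j + 1) i : ℝ) = (j + 1) * Nat.choose j i := by
    have := Nat.choose_mul_succ_eq j i
    have h3 : ((Nat.choose j i * (j + 1) : ℕ) : ℝ) =
      ((Nat.choose (j + 1) i * (j + 1 - i) : ℕ) : ℝ) := by rw [this]
    push_cast at h3 ⊢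
    linarith
  rw [pow_succ]
  linear_combination (-1 : ℝ) ^ i * ((j + 1 - i : ℕ) : ℝ) ^ k * h2

theorem surjection_sum_eq (k j : ℕ) :
    ∑ i ∈ range (j + 1), (-1 : ℝ) ^ i * (Nat.choose j i : ℝ) * ((j - i : ℕ) : ℝ) ^ k =
      j.factorial * Nat.stirlingSecond k j := by
  induction k generalizing j with
  | zero =>
    cases j with
    | zero => simp
    | succ j =>
      have := Int.alternating_sum_range_choose_of_ne (n := j + 1) (by simp)
      simpa using congrArg (Int.cast : ℤ → ℝ) this
  | succ k ih =>
    cases j with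
    | zero => simp
    | succ j =>
      rw [surjection_sum_succ, ih, ih, Nat.stirlingSecond_succ_succ, Nat.factorial_succ]
      push_cast
      ring

theorem a_eq (n j : ℕ) : a n j = Nat.choose n j * n.factorial * surjCoeff n j := by
  unfold a stirling2 surjCoeff
  rw [surjection_sum_eq]
  field_simp

theorem surjCoeff_nonneg (k j : ℕ) : 0 ≤ surjCoeff k j := by
  unfold surjCoeff; positivity

theorem surjCoeff_succ (k j : ℕ) :
    (k + 1) * surjCoeff (k + 1) (j + 1) = (j + 1) * (surjCoeff k (j + 1) + surjCoeff k j) := by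
  unfold surjCoeff
  rw [Nat.stirlingSecond_succ_succ, Nat.factorial_succ, Nat.factorial_succ]
  push_cast
  have : (k.factorial : ℝ) ≠ 0 := by positivity
  field_simp

theorem hasSum_surjCoeff (j : ℕ) (y : ℝ) :
    HasSum (fun k => surjCoeff k j * y ^ k) ((Real.exp y - 1) ^ j) := by
  have h : ∀ i ∈ range (j + 1),
      HasSum (fun k : ℕ => (-1 : ℝ) ^ i * (Nat.choose j i : ℝ) *
        ((((j - i : ℕ) : ℝ) * y) ^ k / k.factorial))
        ((-1 : ℝ) ^ i * (Nat.choose j i : ℝ) * Real.exp (((j - i : ℕ) : ℝ) * y)) := by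
    intro i _
    have h := NormedSpace.expSeries_div_hasSum_exp (((j - i : ℕ) : ℝ) * y)
    rw [← Real.exp_eq_exp_ℝ] at h
    exact h.mul_left _
  have hval : (Real.exp y - 1) ^ j = ∑ i ∈ range (j + 1),
      (-1 : ℝ) ^ i * (Nat.choose j i : ℝ) * Real.exp (((j - i : ℕ) : ℝ) * y) := by
    rw [sub_eq_neg_add, add_pow]
    refine sum_congr rfl fun i _ => ?_
    rw [Real.exp_nat_mul]
    ring
  rw [hval]
  refine (hasSum_sum h).congr_fun fun k => ?_
  rw [surjCoeff, ← surjection_sum_eq, div_mul_eq_mul_div, sum_mul, sum_div]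
  refine sum_congr rfl fun i _ => ?_
  rw [mul_pow]
  ring

theorem hasSum_of_hasSum_succ {f : ℕ → ℝ} {s : ℝ} (h0 : f 0 = 0)
    (h : HasSum (fun k => f (k + 1)) s) : HasSum f s := by
  have := (hasSum_nat_add_iff (f := f) (g := s) 1).1 h
  simpa [h0] using this

theorem hasSum_mul_surjCoeff (j : ℕ) (y : ℝ) :
    HasSum (fun k : ℕ => (k : ℝ) * (surjCoeff k j * y ^ k))
      (j * y * Real.exp y * (Real.exp y - 1) ^ (j - 1)) := by
  refine hasSum_of_hasSum_succ (by simp) ?_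
  cases j with
  | zero =>
    simp [surjCoeff]
  | succ j =>
    have hval : ((j + 1 : ℕ) : ℝ) * y * Real.exp y * (Real.exp y - 1) ^ (j + 1 - 1) =
        ((j + 1) * y) * ((Real.exp y - 1) ^ (j + 1) + (Real.exp y - 1) ^ j) := by
      rw [Nat.add_sub_cancel]
      push_cast
      ring
    rw [hval]
    refine (((hasSum_surjCoeff (j + 1) y).add (hasSum_surjCoeff j y)).mul_left
      (((j : ℝ) + 1) * y)).congr_fun fun k => ?_
    have := surjCoeff_succ k j
    push_cast
    rw [pow_succ]
    linear_combination y ^ k * y * this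

theorem hasSum_sq_mul_surjCoeff (j : ℕ) (y : ℝ) :
    HasSum (fun k : ℕ => (k : ℝ) ^ 2 * (surjCoeff k (j + 1) * y ^ k))
      ((j + 1) * y * Real.exp y * (Real.exp y - 1) ^ j +
        (j + 1) * y * ((j + 1) * y * Real.exp y * (Real.exp y - 1) ^ j +
          j * y * Real.exp y * (Real.exp y - 1) ^ (j - 1))) := by
  refine hasSum_of_hasSum_succ (by simp) ?_
  have hs := (((hasSum_surjCoeff (j + 1) y).add (hasSum_surjCoeff j y)).add
    ((hasSum_mul_surjCoeff (j + 1) y).add (hasSum_mul_surjCoeff j y))).mul_left (((j : ℝ) + 1) * y)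
  rw [Nat.add_sub_cancel] at hs
  push_cast at hs
  have hval : ((j : ℝ) + 1) * y * Real.exp y * (Real.exp y - 1) ^ j +
        (j + 1) * y * ((j + 1) * y * Real.exp y * (Real.exp y - 1) ^ j +
          j * y * Real.exp y * (Real.exp y - 1) ^ (j - 1)) = ((j : ℝ) + 1) * y *
      ((Real.exp y - 1) ^ (j + 1) + (Real.exp y - 1) ^ j +
        (((j : ℝ) + 1) * y * Real.exp y * (Real.exp y - 1) ^ j +
          j * y * Real.exp y * (Real.exp y - 1) ^ (j - 1))) := by ring
  rw [hval]
  refine hs.congr_fun fun k => ?_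
  have := surjCoeff_succ k j
  push_cast
  rw [pow_succ y]
  linear_combination (k + 1) * y ^ k * y * this

theorem stirlingSecond_pos {n k : ℕ} (hk : 1 ≤ k) (h : k ≤ n) : 0 < Nat.stirlingSecond n k := by
  induction n generalizing k with
  | zero => omega
  | succ n ih =>
    obtain ⟨k, rfl⟩ := Nat.exists_eq_add_of_le' hk
    rw [Nat.stirlingSecond_succ_succ]
    rcases Nat.lt_or_ge n (k + 1) with h' | h'
    · obtain rfl : n = k := by omega
      simp [Nat.stirlingSecond_self]
    · have := ih hk h'
      positivity

theorem stirlingSecond_mul_le (n : ℕ) {i j : ℕ} (hij : i ≤ j) :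
    Nat.stirlingSecond n i * Nat.stirlingSecond n (j + 1) ≤
      Nat.stirlingSecond n (i + 1) * Nat.stirlingSecond n j := by
  induction n generalizing i j with
  | zero => simp
  | succ n ih =>
    cases i with
    | zero => simp
    | succ i =>
      rcases eq_or_lt_of_le hij with rfl | hlt
      · exact (mul_comm _ _).le
      obtain ⟨d, rfl⟩ := Nat.exists_eq_add_of_le hlt
      have h1 := ih (show i + 1 ≤ i + 1 + 1 + d by omega)
      have h2 := ih (show i ≤ i + 1 + d by omega)
      have h3 := ih (show i ≤ i + 1 + 1 + d by omega)
      have h4 := ih (show i + 1 ≤ i + 1 + d by omega)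
      rw [show (i + 1).succ + d = i + 1 + d + 1 by omega]
      rw [show i + 1 + 1 + d = i + 1 + d + 1 by omega] at h1 h3
      simp only [Nat.stirlingSecond_succ_succ]
      set L := Nat.stirlingSecond n
      nlinarith [Nat.mul_le_mul_left ((i + 1) * (i + 1 + d + 2)) h1,
        Nat.mul_le_mul_left (d + 1) (Nat.zero_le (L (i + 2) * L (i + 1 + d + 1))),
        Nat.mul_le_mul_left (i + 2) h4, Nat.mul_le_mul_left (i + 1 + d + 2) h3]

theorem stirlingSecond_succ_mul_le (k j : ℕ) :
    Nat.stirlingSecond (k + 1) j * Nat.stirlingSecond k (j + 1) ≤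
      Nat.stirlingSecond k j * Nat.stirlingSecond (k + 1) (j + 1) := by
  cases j with
  | zero => simp
  | succ i =>
    have h := stirlingSecond_mul_le k (Nat.le_succ i)
    simp only [Nat.stirlingSecond_succ_succ, Nat.succ_eq_add_one] at h ⊢
    nlinarith [Nat.zero_le (Nat.stirlingSecond k (i + 1) * Nat.stirlingSecond k (i + 1 + 1))]

theorem surjCoeff_pos {k j : ℕ} (hj : 1 ≤ j) (h : j ≤ k) : 0 < surjCoeff k j := by
  have := stirlingSecond_pos hj h
  unfold surjCoeff
  positivity

theorem surjCoeff_eq_zero {k j : ℕ} (h : k < j) : surjCoeff k j = 0 := by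
  simp [surjCoeff, Nat.stirlingSecond_eq_zero_of_lt h]

theorem surjCoeff_logConcave (k j : ℕ) :
    surjCoeff k (j + 1) * surjCoeff (k + 2) (j + 1) ≤ surjCoeff (k + 1) (j + 1) ^ 2 := by
  have h1 := surjCoeff_succ k j
  have h2 := surjCoeff_succ (k + 1) j
  have h3 : surjCoeff (k + 1) j * surjCoeff k (j + 1) ≤
      surjCoeff k j * surjCoeff (k + 1) (j + 1) := by
    have := stirlingSecond_succ_mul_le k j
    have h4 : (Nat.stirlingSecond (k + 1) j : ℝ) * Nat.stirlingSecond k (j + 1) ≤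
      Nat.stirlingSecond k j * Nat.stirlingSecond (k + 1) (j + 1) := by exact_mod_cast this
    have h5 := mul_le_mul_of_nonneg_left h4
      (show (0 : ℝ) ≤ (j.factorial : ℝ) / ((k + 1).factorial : ℝ) *
        (((j + 1).factorial : ℝ) / (k.factorial : ℝ)) by positivity)
    unfold surjCoeff
    refine le_trans (le_of_eq ?_) (h5.trans (le_of_eq ?_)) <;> ring
  push_cast at h2
  rw [show k + 1 + 1 = k + 2 from rfl] at h2
  have hk : (0 : ℝ) < k + 2 := by positivity
  refine le_of_mul_le_mul_left ?_ hk
  have h6 := mul_le_mul_of_nonneg_left h3 (show (0 : ℝ) ≤ j + 1 by positivity)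
  have h7 : (k + 2) * (surjCoeff k (j + 1) * surjCoeff (k + 2) (j + 1)) =
      (j + 1) * (surjCoeff (k + 1) (j + 1) * surjCoeff k (j + 1)) +
        (j + 1) * (surjCoeff (k + 1) j * surjCoeff k (j + 1)) := by
    linear_combination surjCoeff k (j + 1) * h2
  have h8 : (k + 1) * surjCoeff (k + 1) (j + 1) ^ 2 =
      (j + 1) * (surjCoeff (k + 1) (j + 1) * surjCoeff k (j + 1)) +
        (j + 1) * (surjCoeff k j * surjCoeff (k + 1) (j + 1)) := by
    linear_combination surjCoeff (k + 1) (j + 1) * h1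
  linarith [sq_nonneg (surjCoeff (k + 1) (j + 1))]

theorem surjCoeff_ratio_le {j : ℕ} (hj : 1 ≤ j) {k m : ℕ} (h : k ≤ m) :
    surjCoeff k j * surjCoeff (m + 1) j ≤ surjCoeff (k + 1) j * surjCoeff m j := by
  rcases Nat.lt_or_ge k j with hk | hk
  · rw [surjCoeff_eq_zero hk, zero_mul]
    exact mul_nonneg (surjCoeff_nonneg _ _) (surjCoeff_nonneg _ _)
  induction m, h using Nat.le_induction with
  | base => exact (mul_comm _ _).le
  | succ m hm ih =>
    obtain ⟨i, rfl⟩ := Nat.exists_eq_add_of_le' hj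
    have h1 := surjCoeff_logConcave m i
    have h2 := surjCoeff_pos hj (hk.trans hm)
    have h3 := surjCoeff_pos hj (hk.trans (hm.trans (Nat.le_succ m)))
    have h4 := surjCoeff_nonneg (k + 1) (i + 1)
    have h5 := surjCoeff_pos hj hk
    have h6 := mul_le_mul_of_nonneg_left h1 h5.le
    have h7 := mul_le_mul_of_nonneg_right ih h3.le
    refine le_of_mul_le_mul_left ?_ h2
    rw [Nat.succ_eq_add_one] at *
    rw [show m + 1 + 1 = m + 2 from rfl]
    nlinarith

/-- Tilting by the ratio of consecutive coefficients makes `n` a mode. -/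
theorem surjCoeff_mul_pow_le_mode {j n : ℕ} (hj : 1 ≤ j) (hjn : j ≤ n) {y : ℝ} (hy : 0 < y)
    (h : y * surjCoeff (n + 1) j = surjCoeff n j) (k : ℕ) :
    surjCoeff k j * y ^ k ≤ surjCoeff n j * y ^ n := by
  have hp := surjCoeff_pos hj (hjn.trans (Nat.le_succ n))
  rw [Nat.succ_eq_add_one] at hp
  rcases le_total k n with hk | hk
  · refine Nat.decreasingInduction' (P := fun i => surjCoeff i j * y ^ i ≤ surjCoeff n j * y ^ n)
      (fun i hi _ ih => le_trans ?_ ih) hk le_rfl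
    have h1 := surjCoeff_ratio_le hj hi.le
    rw [← h] at h1
    have h2 : surjCoeff i j ≤ surjCoeff (i + 1) j * y :=
      le_of_mul_le_mul_right (by linarith) hp
    calc _ ≤ surjCoeff (i + 1) j * y * y ^ i := by gcongr
      _ = _ := by ring
  · induction k, hk using Nat.le_induction with
    | base => rfl
    | succ m hm ih =>
      refine le_trans ?_ ih
      have h1 := surjCoeff_ratio_le hj hm
      rw [← h] at h1
      have h2 : surjCoeff (m + 1) j * y ≤ surjCoeff m j :=
        le_of_mul_le_mul_right (by linarith) hp
      calc _ = surjCoeff (m + 1) j * y * y ^ m := by ring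
        _ ≤ _ := by gcongr

theorem total_mass_le_of_mode {u : ℕ → ℝ} {F M m Q V L : ℝ} (hu : ∀ k, 0 ≤ u k) (hM : ∀ k, u k ≤ M)
    (hm : 0 ≤ m) (h0 : HasSum u F) (h1 : HasSum (fun k : ℕ => (k : ℝ) * u k) (m * F))
    (h2 : HasSum (fun k : ℕ => (k : ℝ) ^ 2 * u k) Q) (hQ : Q ≤ m ^ 2 * F + V * F) (hL : 0 < L)
    (hV : 2 * V ≤ L ^ 2) : F ≤ 2 * (2 * L + 1) * M := by
  set s := Finset.Icc ⌈m - L⌉₊ ⌊m + L⌋₊ with hs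
  have hM0 : 0 ≤ M := (hu 0).trans (hM 0)
  have hF : 0 ≤ F := h0.nonneg hu
  have hcard : (s.card : ℝ) ≤ 2 * L + 1 := by
    rw [hs, Nat.card_Icc]
    rcases le_total ⌈m - L⌉₊ (⌊m + L⌋₊ + 1) with h | h
    · rw [Nat.cast_sub h]
      push_cast
      linarith [Nat.floor_le (show 0 ≤ m + L by positivity), Nat.le_ceil (m - L)]
    · rw [Nat.sub_eq_zero_of_le h]
      push_cast
      linarith
  have hind : HasSum (fun k => if k ∈ s then M else 0) (s.card * M) := by
    have := hasSum_sum_of_ne_finset_zero (f := fun k => if k ∈ s then M else 0) (s := s)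
      (L := SummationFilter.unconditional ℕ) (fun b hb => by simp [hb])
    simpa [Finset.sum_ite_mem] using this
  have hvar : HasSum (fun k : ℕ => u k * ((k : ℝ) - m) ^ 2 / L ^ 2)
      ((Q - 2 * m * (m * F) + m ^ 2 * F) / L ^ 2) := by
    refine (((h2.sub (h1.mul_left (2 * m))).add (h0.mul_left (m ^ 2))).div_const
      (L ^ 2)).congr_fun fun k => ?_
    ring
  have hle : F ≤ s.card * M + (Q - 2 * m * (m * F) + m ^ 2 * F) / L ^ 2 := by
    refine hasSum_le (fun k => ?_) h0 (hind.add hvar)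
    have hk0 : 0 ≤ u k * ((k : ℝ) - m) ^ 2 / L ^ 2 := by have := hu k; positivity
    by_cases hk : k ∈ s
    · simp only [hk, if_true]
      linarith [hM k]
    · simp only [hk, if_false, zero_add]
      rw [le_div_iff₀ (by positivity)]
      refine mul_le_mul_of_nonneg_left ?_ (hu k)
      rw [hs, Finset.mem_Icc, not_and_or, not_le, not_le, Nat.lt_ceil,
        Nat.floor_lt (by positivity)] at hk
      rcases hk with hk | hk
      · nlinarith
      · nlinarith
  have hfrac : (Q - 2 * m * (m * F) + m ^ 2 * F) / L ^ 2 ≤ F / 2 := by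
    rw [div_le_iff₀ (by positivity)]
    nlinarith [mul_le_mul_of_nonneg_right hV hF]
  nlinarith [mul_le_mul_of_nonneg_right hcard hM0]

theorem exists_pow_le_surjCoeff {j n : ℕ} (hj : 1 ≤ j) (hjn : j ≤ n) :
    ∃ y : ℝ, 0 < y ∧
      (Real.exp y - 1) ^ j ≤ 12 * Real.sqrt n * (surjCoeff n j * y ^ n) := by
  have hp := surjCoeff_pos hj hjn
  have hp' := surjCoeff_pos hj (hjn.trans (Nat.le_succ n))
  rw [Nat.succ_eq_add_one] at hp'
  set y := surjCoeff n j / surjCoeff (n + 1) j with hy_def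
  have hy : 0 < y := by positivity
  have hyb : y * surjCoeff (n + 1) j = surjCoeff n j := by rw [hy_def]; field_simp
  refine ⟨y, hy, ?_⟩
  have hmode := surjCoeff_mul_pow_le_mode hj hjn hy hyb
  obtain ⟨i, rfl⟩ := Nat.exists_eq_add_of_le' hj
  have hyn : ((i : ℝ) + 1) * y ≤ n + 1 := by
    refine le_of_mul_le_mul_right ?_ hp'
    have := surjCoeff_succ n i
    have h0 := surjCoeff_nonneg n i
    rw [mul_assoc, hyb, this]
    nlinarith [Nat.cast_nonneg (α := ℝ) i]
  have hE : 0 < Real.exp y - 1 := by linarith [Real.add_one_le_exp y]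
  set m : ℝ := (i + 1) * y * Real.exp y / (Real.exp y - 1) with hm_def
  have hm0 : 0 ≤ m := by positivity
  have hn : (i : ℝ) + 1 ≤ n := by exact_mod_cast hjn
  have hn1 : (1 : ℝ) ≤ n := by linarith [Nat.cast_nonneg (α := ℝ) i]
  have hm : m ≤ 3 * n := by
    rw [hm_def, div_le_iff₀ hE]
    have h1 : y * Real.exp y ≤ (1 + y) * (Real.exp y - 1) := by
      nlinarith [Real.add_one_le_exp y]
    have h2 := mul_le_mul_of_nonneg_left h1 (show (0 : ℝ) ≤ i + 1 by positivity)
    have h3 : ((i : ℝ) + 1) * (1 + y) ≤ 3 * n := by linarith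
    have h4 := mul_le_mul_of_nonneg_right h3 hE.le
    nlinarith
  have h1 : HasSum (fun k : ℕ => (k : ℝ) * (surjCoeff k (i + 1) * y ^ k))
      (m * (Real.exp y - 1) ^ (i + 1)) := by
    have h := hasSum_mul_surjCoeff (i + 1) y
    have hval : m * (Real.exp y - 1) ^ (i + 1) = ((i + 1 : ℕ) : ℝ) * y * Real.exp y *
        (Real.exp y - 1) ^ (i + 1 - 1) := by
      rw [hm_def, Nat.add_sub_cancel, pow_succ]
      push_cast
      field_simp
    rw [hval]
    exact h
  have hQ : (i + 1) * y * Real.exp y * (Real.exp y - 1) ^ i +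
        (i + 1) * y * ((i + 1) * y * Real.exp y * (Real.exp y - 1) ^ i +
          i * y * Real.exp y * (Real.exp y - 1) ^ (i - 1)) ≤
      m ^ 2 * (Real.exp y - 1) ^ (i + 1) + m * (Real.exp y - 1) ^ (i + 1) := by
    have hmE : m * (Real.exp y - 1) = (i + 1) * y * Real.exp y := by
      rw [hm_def]; field_simp
    have hlast : i * y * Real.exp y * (Real.exp y - 1) ^ (i - 1) ≤ m * (Real.exp y - 1) ^ i := by
      cases i with
      | zero => simp; positivity
      | succ i =>
        rw [Nat.add_sub_cancel, pow_succ', ← mul_assoc, hmE]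
        push_cast
        gcongr
        linarith
    have h5 := mul_le_mul_of_nonneg_left hlast (show 0 ≤ ((i : ℝ) + 1) * y by positivity)
    rw [pow_succ' (Real.exp y - 1)]
    have h6 : m ^ 2 * ((Real.exp y - 1) * (Real.exp y - 1) ^ i) =
        (i + 1) * y * ((i + 1) * y * Real.exp y * (Real.exp y - 1) ^ i +
          m * (Real.exp y - 1) ^ i) := by
      linear_combination (m + (i + 1) * y) * (Real.exp y - 1) ^ i * hmE
    rw [h6]
    have h7 : m * ((Real.exp y - 1) * (Real.exp y - 1) ^ i) =
        (i + 1) * y * Real.exp y * (Real.exp y - 1) ^ i := by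
      linear_combination (Real.exp y - 1) ^ i * hmE
    rw [h7]
    linarith
  have hs6 : Real.sqrt (6 * n) ^ 2 = 6 * n := Real.sq_sqrt (by positivity)
  have key := total_mass_le_of_mode (u := fun k => surjCoeff k (i + 1) * y ^ k)
    (fun k => mul_nonneg (surjCoeff_nonneg _ _) (by positivity)) hmode hm0
    (hasSum_surjCoeff (i + 1) y) h1 (hasSum_sq_mul_surjCoeff i y) hQ
    (L := Real.sqrt (6 * n)) (by positivity) (by rw [hs6]; linarith)
  refine key.trans (mul_le_mul_of_nonneg_right ?_ (by positivity))
  have h8 : Real.sqrt (6 * n) ≤ 5 / 2 * Real.sqrt n := by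
    rw [Real.sqrt_mul (by norm_num)]
    gcongr
    rw [Real.sqrt_le_left (by norm_num)]
    norm_num
  have h9 : 1 ≤ Real.sqrt n := Real.one_le_sqrt.2 hn1
  linarith

theorem saddle_le {j n : ℕ} {ρ y : ℝ} (hρ : 0 < ρ) (hy : 0 < y) (hj : 1 ≤ j)
    (h : j * ρ * Real.exp ρ = n * (Real.exp ρ - 1)) :
    (Real.exp ρ - 1) ^ j * y ^ n ≤ (Real.exp y - 1) ^ j * ρ ^ n := by
  set t := Real.log (y / ρ) with ht
  have hyt : y = ρ * Real.exp t := by rw [ht, Real.exp_log (by positivity)]; field_simp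
  have h0 := hasSum_surjCoeff j ρ
  have h1 : HasSum (fun k : ℕ => (k : ℝ) * (surjCoeff k j * ρ ^ k))
      (n * (Real.exp ρ - 1) ^ j) := by
    have hval : n * (Real.exp ρ - 1) ^ j = j * ρ * Real.exp ρ * (Real.exp ρ - 1) ^ (j - 1) := by
      obtain ⟨i, rfl⟩ := Nat.exists_eq_add_of_le' hj
      rw [h, Nat.add_sub_cancel, pow_succ]
      ring
    rw [hval]
    exact hasSum_mul_surjCoeff j ρ
  have h2 := (((h1.sub (h0.mul_left (n : ℝ))).mul_left t).add h0).mul_left (Real.exp t ^ n)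
  have h3 : Real.exp t ^ n * (Real.exp ρ - 1) ^ j ≤ (Real.exp y - 1) ^ j := by
    have h4 := hasSum_le (fun k => ?_) h2 (hasSum_surjCoeff j y)
    · refine le_trans (le_of_eq ?_) h4
      ring
    · have h5 : Real.exp t ^ n * (t * (k - n) + 1) ≤ Real.exp t ^ k := by
        rw [← Real.exp_nat_mul, ← Real.exp_nat_mul,
          show (k : ℝ) * t = n * t + t * (k - n) by ring, Real.exp_add]
        gcongr
        exact Real.add_one_le_exp _
      have h6 := mul_le_mul_of_nonneg_left h5
        (mul_nonneg (surjCoeff_nonneg k j) (pow_nonneg hρ.le k))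
      rw [hyt, mul_pow]
      refine le_trans (le_of_eq ?_) (h6.trans (le_of_eq ?_))
      · ring
      · ring
  calc _ = Real.exp t ^ n * (Real.exp ρ - 1) ^ j * ρ ^ n := by
        rw [show y ^ n = ρ ^ n * Real.exp t ^ n by rw [← mul_pow, ← hyt]]
        ring
    _ ≤ _ := by gcongr

theorem surjCoeff_mul_pow_le {y : ℝ} (hy : 0 ≤ y) (n j : ℕ) :
    surjCoeff n j * y ^ n ≤ (Real.exp y - 1) ^ j :=
  le_hasSum (hasSum_surjCoeff j y) n fun k _ => mul_nonneg (surjCoeff_nonneg _ _) (by positivity)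

theorem saddle_le_surjCoeff {j n : ℕ} {ρ : ℝ} (hρ : 0 < ρ) (hj : 1 ≤ j) (hjn : j ≤ n)
    (h : j * ρ * Real.exp ρ = n * (Real.exp ρ - 1)) :
    (Real.exp ρ - 1) ^ j ≤ 12 * Real.sqrt n * (surjCoeff n j * ρ ^ n) := by
  obtain ⟨y, hy, hle⟩ := exists_pow_le_surjCoeff hj hjn
  refine le_of_mul_le_mul_right ((saddle_le hρ hy hj h).trans ?_) (pow_pos hy n)
  calc _ ≤ 12 * Real.sqrt n * (surjCoeff n j * y ^ n) * ρ ^ n := by gcongr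
    _ = _ := by ring

theorem sqrt_mul_pow_le_factorial (n : ℕ) :
    Real.sqrt n * (n / Real.exp 1) ^ n ≤ n.factorial := by
  refine le_trans ?_ (Stirling.le_factorial_stirling n)
  gcongr
  nlinarith [Real.pi_gt_three, Nat.cast_nonneg (α := ℝ) n]

theorem factorial_le_sqrt_mul_pow {n : ℕ} (hn : 1 ≤ n) :
    (n.factorial : ℝ) ≤ 3 * Real.sqrt n * (n / Real.exp 1) ^ n := by
  obtain ⟨k, rfl⟩ := Nat.exists_eq_add_of_le' hn
  have h : Stirling.stirlingSeq (k + 1) ≤ Stirling.stirlingSeq 1 :=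
    Stirling.stirlingSeq'_antitone (Nat.zero_le k)
  rw [Stirling.stirlingSeq_one, Stirling.stirlingSeq, div_le_iff₀ (by positivity),
    Real.sqrt_mul (by norm_num)] at h
  have h2 : Real.exp 1 / √2 * (√2 * √((k + 1 : ℕ) : ℝ) * (((k + 1 : ℕ) : ℝ) / Real.exp 1) ^ (k + 1))
      = Real.exp 1 * √((k + 1 : ℕ) : ℝ) * (((k + 1 : ℕ) : ℝ) / Real.exp 1) ^ (k + 1) := by
    field_simp
  rw [h2] at h
  refine h.trans ?_
  gcongr
  linarith [Real.exp_one_lt_d9]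

section Entropy

variable {j m : ℕ}

theorem choose_mul_factorials_cast (j m : ℕ) :
    ((j + m).choose j : ℝ) * j.factorial * m.factorial = (j + m).factorial := by
  have h := Nat.choose_mul_factorial_mul_factorial (Nat.le_add_right j m)
  rw [Nat.add_sub_cancel_left] at h
  exact_mod_cast h

theorem pow_div_exp_mul (j m : ℕ) :
    ((j : ℝ) / Real.exp 1) ^ j * ((m : ℝ) / Real.exp 1) ^ m * Real.exp 1 ^ (j + m) =
      (j : ℝ) ^ j * (m : ℝ) ^ m := by
  rw [div_pow, div_pow, pow_add]
  field_simp

theorem choose_mul_factorial_le {x : ℝ} (hj : 1 ≤ j) (hm : 1 ≤ m) (hx : 0 < x)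
    (h : x * ((j + m : ℕ) : ℝ) ≤ Real.sqrt j * Real.sqrt m) :
    ((j + m).choose j : ℝ) * (j + m).factorial * ((j : ℝ) ^ j * (m : ℝ) ^ m) ≤
      9 / x * ((((j + m : ℕ) : ℝ) / Real.exp 1) ^ (j + m) * ((j + m : ℕ) : ℝ) ^ (j + m)) := by
  set n := j + m with hn
  have hn0 : (0 : ℝ) < n := by rw [hn]; positivity
  have hup := factorial_le_sqrt_mul_pow (show 1 ≤ n by omega)
  have hlow := mul_le_mul (sqrt_mul_pow_le_factorial j) (sqrt_mul_pow_le_factorial m)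
    (by positivity) (by positivity)
  have hsq : (n.factorial : ℝ) * n.factorial ≤
      9 * n * ((n : ℝ) / Real.exp 1) ^ n * ((n : ℝ) / Real.exp 1) ^ n := by
    refine (mul_le_mul hup hup (by positivity) (by positivity)).trans (le_of_eq ?_)
    linear_combination 9 * ((n : ℝ) / Real.exp 1) ^ n * ((n : ℝ) / Real.exp 1) ^ n *
      Real.mul_self_sqrt hn0.le
  rw [div_mul_eq_mul_div, le_div_iff₀ hx]
  refine le_of_mul_le_mul_right ?_ hn0
  calc (n.choose j : ℝ) * n.factorial * ((j : ℝ) ^ j * (m : ℝ) ^ m) * x * n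
      = (n.choose j : ℝ) * n.factorial * ((j : ℝ) ^ j * (m : ℝ) ^ m) * (x * n) := by ring
    _ ≤ (n.choose j : ℝ) * n.factorial * ((j : ℝ) ^ j * (m : ℝ) ^ m) *
        (Real.sqrt j * Real.sqrt m) := by gcongr
    _ = (n.choose j : ℝ) * n.factorial * Real.exp 1 ^ n *
        (Real.sqrt j * (j / Real.exp 1) ^ j * (Real.sqrt m * (m / Real.exp 1) ^ m)) := by
        rw [← pow_div_exp_mul]; ring
    _ ≤ (n.choose j : ℝ) * n.factorial * Real.exp 1 ^ n * (j.factorial * m.factorial) := by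
        gcongr
    _ = Real.exp 1 ^ n * (n.factorial * n.factorial) := by
        rw [hn, ← choose_mul_factorials_cast j m]; ring
    _ ≤ Real.exp 1 ^ n *
        (9 * n * ((n : ℝ) / Real.exp 1) ^ n * ((n : ℝ) / Real.exp 1) ^ n) := by gcongr
    _ = 9 * (((n : ℝ) / Real.exp 1) ^ n * (n : ℝ) ^ n) * n := by
        rw [div_pow]; field_simp

theorem le_choose_mul_factorial (hj : 1 ≤ j) (hm : 1 ≤ m) :
    (((j + m : ℕ) : ℝ) / Real.exp 1) ^ (j + m) * ((j + m : ℕ) : ℝ) ^ (j + m) ≤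
      9 * (((j + m).choose j : ℝ) * (j + m).factorial * ((j : ℝ) ^ j * (m : ℝ) ^ m)) := by
  set n := j + m with hn
  have hn0 : (0 : ℝ) < n := by rw [hn]; positivity
  have hlow := sqrt_mul_pow_le_factorial n
  have hup := mul_le_mul (factorial_le_sqrt_mul_pow hj) (factorial_le_sqrt_mul_pow hm)
    (by positivity) (by positivity)
  have hsq : n * ((n : ℝ) / Real.exp 1) ^ n * ((n : ℝ) / Real.exp 1) ^ n ≤
      (n.factorial : ℝ) * n.factorial := by
    refine le_trans (le_of_eq ?_) (mul_le_mul hlow hlow (by positivity) (by positivity))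
    linear_combination -((n : ℝ) / Real.exp 1) ^ n * ((n : ℝ) / Real.exp 1) ^ n *
      Real.mul_self_sqrt hn0.le
  have hs : Real.sqrt j * Real.sqrt m ≤ n := by
    rw [← Real.sqrt_mul (by positivity), Real.sqrt_le_left hn0.le, hn]
    push_cast
    nlinarith [Nat.cast_nonneg (α := ℝ) j, Nat.cast_nonneg (α := ℝ) m]
  refine le_of_mul_le_mul_right ?_ hn0
  calc ((n : ℝ) / Real.exp 1) ^ n * (n : ℝ) ^ n * n
      = Real.exp 1 ^ n * (n * ((n : ℝ) / Real.exp 1) ^ n * ((n : ℝ) / Real.exp 1) ^ n) := by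
        rw [div_pow]; field_simp
    _ ≤ Real.exp 1 ^ n * (n.factorial * n.factorial) := by gcongr
    _ = (n.choose j : ℝ) * n.factorial * Real.exp 1 ^ n * (j.factorial * m.factorial) := by
        rw [hn, ← choose_mul_factorials_cast j m]; ring
    _ ≤ (n.choose j : ℝ) * n.factorial * Real.exp 1 ^ n *
        (3 * Real.sqrt j * (j / Real.exp 1) ^ j * (3 * Real.sqrt m * (m / Real.exp 1) ^ m)) := by
        gcongr
    _ = 9 * ((n.choose j : ℝ) * n.factorial * ((j : ℝ) ^ j * (m : ℝ) ^ m)) *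
        (Real.sqrt j * Real.sqrt m) := by
        rw [← pow_div_exp_mul]; ring
    _ ≤ _ := by gcongr

theorem varphi_pow (hj : 1 ≤ j) (hm : 1 ≤ m) :
    varphi ((j : ℝ) / (j + m : ℕ)) ^ (j + m) * ((j : ℝ) ^ j * (m : ℝ) ^ m) =
      ((j + m : ℕ) : ℝ) ^ (j + m) := by
  have hn0 : (0 : ℝ) < (j + m : ℕ) := by positivity
  have hj0 : (0 : ℝ) < j := by positivity
  have hm0 : (0 : ℝ) < m := by positivity
  have key : ∀ k : ℕ, 1 ≤ k → (((k : ℝ) / (j + m : ℕ)) ^ (-((k : ℝ) / (j + m : ℕ)))) ^ (j + m) =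
      ((j + m : ℕ) : ℝ) ^ k / (k : ℝ) ^ k := by
    intro k hk
    rw [← Real.rpow_natCast, ← Real.rpow_mul (by positivity), neg_mul, div_mul_cancel₀ _ hn0.ne',
      Real.rpow_neg (by positivity), Real.rpow_natCast, div_pow, inv_div]
  have h1 : 1 - (j : ℝ) / (j + m : ℕ) = m / (j + m : ℕ) := by
    field_simp
    push_cast
    ring
  rw [varphi, h1, mul_pow, key j hj, key m hm, pow_add]
  field_simp

theorem phi_pow (δ : ℝ → ℝ) (hj : 1 ≤ j) (hm : 1 ≤ m) {ρ : ℝ} (hρ : 0 < ρ)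
    (h : Real.log (1 + Real.exp (-(δ ((j : ℝ) / (j + m : ℕ))))) = ρ) :
    phi δ ((j : ℝ) / (j + m : ℕ)) ^ (j + m) * ((j + m : ℕ) : ℝ) ^ (j + m) *
        (ρ ^ (j + m) * ((j : ℝ) ^ j * (m : ℝ) ^ m)) =
      (((j + m : ℕ) : ℝ) / Real.exp 1) ^ (j + m) * ((j + m : ℕ) : ℝ) ^ (j + m) *
        (Real.exp ρ - 1) ^ j := by
  have hn0 : (0 : ℝ) < (j + m : ℕ) := by positivity
  have hE : Real.exp ρ - 1 = Real.exp (-(δ ((j : ℝ) / (j + m : ℕ)))) := by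
    rw [← h, Real.exp_log (by positivity)]
    ring
  have hδ : Real.exp (-((j : ℝ) / (j + m : ℕ) * δ ((j : ℝ) / (j + m : ℕ)))) ^ (j + m) =
      (Real.exp ρ - 1) ^ j := by
    rw [hE, ← Real.exp_nat_mul, ← Real.exp_nat_mul]
    congr 1
    field_simp
  rw [phi, h, mul_pow, mul_pow, hδ, inv_pow, mul_pow, div_pow]
  have hv := varphi_pow hj hm
  field_simp
  linear_combination (Real.exp ρ - 1) ^ j * hv

end Entropy

theorem a_le_of_small {n j : ℕ} (hj : 1 ≤ j) (hjn : j ≤ n) (h : (j : ℝ) ≤ n / 10) :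
    a n j ≤ 3 * Real.sqrt n * (9 / 10) ^ n * (n : ℝ) ^ n := by
  have hj0 : (0 : ℝ) < j := by positivity
  have hb : surjCoeff n j * (n : ℝ) ^ n ≤ Real.exp 1 ^ n * (j : ℝ) ^ n := by
    have h1 := surjCoeff_mul_pow_le (y := (n : ℝ) / j) (by positivity) n j
    have h2 : (Real.exp ((n : ℝ) / j) - 1) ^ j ≤ Real.exp 1 ^ n := by
      calc _ ≤ Real.exp ((n : ℝ) / j) ^ j := by
            gcongr
            · linarith [Real.add_one_le_exp ((n : ℝ) / j),
                show (0 : ℝ) ≤ (n : ℝ) / j by positivity]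
            · linarith
        _ = Real.exp 1 ^ n := by
            rw [← Real.exp_nat_mul, ← Real.exp_nat_mul]
            congr 1
            field_simp
    have h3 := h1.trans h2
    rwa [div_pow, ← mul_div_assoc, div_le_iff₀ (by positivity)] at h3
  have hc : (n.choose j : ℝ) ≤ 2 ^ n := by exact_mod_cast Nat.choose_le_two_pow n j
  have hf := factorial_le_sqrt_mul_pow (hj.trans hjn)
  have hb0 := surjCoeff_nonneg n j
  rw [a_eq]
  calc (n.choose j : ℝ) * n.factorial * surjCoeff n j
      ≤ 2 ^ n * (3 * Real.sqrt n * (n / Real.exp 1) ^ n) * surjCoeff n j := by gcongr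
    _ = 3 * Real.sqrt n * 2 ^ n / Real.exp 1 ^ n * (surjCoeff n j * (n : ℝ) ^ n) := by
        rw [div_pow]; ring
    _ ≤ 3 * Real.sqrt n * 2 ^ n / Real.exp 1 ^ n * (Real.exp 1 ^ n * (j : ℝ) ^ n) := by gcongr
    _ = 3 * Real.sqrt n * (2 ^ n * (j : ℝ) ^ n) := by field_simp
    _ ≤ 3 * Real.sqrt n * (2 ^ n * (n / 10 : ℝ) ^ n) := by gcongr
    _ = 3 * Real.sqrt n * ((1 / 5) ^ n * (n : ℝ) ^ n) := by
        rw [← mul_pow, ← mul_pow]; ring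
    _ ≤ 3 * Real.sqrt n * ((9 / 10) ^ n * (n : ℝ) ^ n) := by
        gcongr 3 * Real.sqrt n * (?_ ^ n * (n : ℝ) ^ n)
        norm_num
    _ = _ := by ring

theorem choose_le_of_ten_mul_le {n m : ℕ} (h : 10 * m ≤ n) :
    (n.choose m : ℝ) ≤ (1386 / 1000) ^ n := by
  have hmn : m ≤ n := by omega
  have h1 : (1 / 10 : ℝ) ^ m * n.choose m ≤ (1 / 10 + 1) ^ n := by
    rw [add_pow]
    simpa using single_le_sum (f := fun i => (1 / 10 : ℝ) ^ i * 1 ^ (n - i) * n.choose i)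
      (fun i _ => by positivity) (mem_range.2 (Nat.lt_succ_of_le hmn))
  have h2 : (10 : ℝ) ^ m ≤ (126 / 100) ^ n := by
    calc (10 : ℝ) ^ m ≤ ((126 / 100) ^ 10) ^ m := by gcongr; norm_num
      _ = (126 / 100) ^ (10 * m) := by rw [pow_mul]
      _ ≤ _ := pow_le_pow_right₀ (by norm_num) h
  calc (n.choose m : ℝ) = 10 ^ m * ((1 / 10 : ℝ) ^ m * n.choose m) := by
        rw [← mul_assoc, ← mul_pow]; norm_num
    _ ≤ (126 / 100) ^ n * (1 / 10 + 1) ^ n := by gcongr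
    _ = _ := by rw [← mul_pow]; norm_num

theorem a_le_of_large {n j : ℕ} (hj : 1 ≤ j) (hjn : j ≤ n) (h : 9 / 10 * (n : ℝ) ≤ j) :
    a n j ≤ 3 * Real.sqrt n * (9 / 10) ^ n * (n : ℝ) ^ n := by
  have he1 := Real.exp_one_gt_d9
  have he2 := Real.exp_one_lt_d9
  have hb : surjCoeff n j ≤ (Real.exp 1 - 1) ^ n := by
    have h1 := surjCoeff_mul_pow_le (y := 1) (by norm_num) n j
    rw [one_pow, mul_one] at h1
    exact h1.trans (pow_le_pow_right₀ (by linarith) hjn)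
  have hc : (n.choose j : ℝ) ≤ (1386 / 1000) ^ n := by
    rw [← Nat.choose_symm hjn]
    refine choose_le_of_ten_mul_le ?_
    have : 9 * n ≤ 10 * j := by
      have : (9 : ℝ) * n ≤ 10 * j := by linarith
      exact_mod_cast this
    omega
  have hf := factorial_le_sqrt_mul_pow (hj.trans hjn)
  have hb0 := surjCoeff_nonneg n j
  have he : 0 ≤ Real.exp 1 - 1 := by linarith
  rw [a_eq]
  calc (n.choose j : ℝ) * n.factorial * surjCoeff n j
      ≤ (1386 / 1000) ^ n * (3 * Real.sqrt n * (n / Real.exp 1) ^ n) *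
        (Real.exp 1 - 1) ^ n := by gcongr
    _ = 3 * Real.sqrt n * (1386 / 1000 * (Real.exp 1 - 1) / Real.exp 1) ^ n * (n : ℝ) ^ n := by
        rw [div_pow (n : ℝ), div_pow _ (Real.exp 1), mul_pow]; ring
    _ ≤ 3 * Real.sqrt n * (9 / 10) ^ n * (n : ℝ) ^ n := by
        gcongr 3 * Real.sqrt n * ?_ ^ n * (n : ℝ) ^ n
        rw [div_le_iff₀ (Real.exp_pos 1)]
        linarith

theorem stmt_0 (δ : ℝ → ℝ)
    (hδ : ∀ x ∈ Set.Ioo (0 : ℝ) 1,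
      (1 + Real.exp (δ x)) * Real.log (1 + Real.exp (-(δ x))) = 1 / x) :
    ∃ r Λ c C : ℝ, 0 < r ∧ r < 1 ∧ 0 < Λ ∧ Λ < 1 ∧ 0 < c ∧ 0 < C ∧
      ∀ n j : ℕ, 1 ≤ j → j ≤ n →
        (((j : ℝ) / n ≤ r ∨ 1 - r ≤ (j : ℝ) / n) →
            a n j ≤ C * Real.sqrt n * Λ ^ n * (n : ℝ) ^ n) ∧
        ((r ≤ (j : ℝ) / n ∧ (j : ℝ) / n ≤ 1 - r) →
            a n j ≤ C * phi δ ((j : ℝ) / n) ^ n * (n : ℝ) ^ n ∧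
            (c / Real.sqrt n) * phi δ ((j : ℝ) / n) ^ n * (n : ℝ) ^ n ≤ a n j) := by
  refine ⟨1 / 10, 9 / 10, 1 / 108, 30, by norm_num, by norm_num, by norm_num, by norm_num,
    by norm_num, by norm_num, fun n j hj hjn => ?_⟩
  have hn0 : (0 : ℝ) < n := by exact_mod_cast hj.trans hjn
  have hj0 : (0 : ℝ) < j := by exact_mod_cast hj
  refine ⟨fun h => ?_, fun ⟨h1, h2⟩ => ?_⟩
  · have hle : a n j ≤ 3 * Real.sqrt n * (9 / 10) ^ n * (n : ℝ) ^ n := by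
      rcases h with h | h
      · rw [div_le_iff₀ hn0] at h
        exact a_le_of_small hj hjn (by linarith)
      · rw [le_div_iff₀ hn0] at h
        exact a_le_of_large hj hjn (by linarith)
    refine hle.trans ?_
    gcongr
    norm_num
  · have hx1 : (j : ℝ) / n < 1 := by linarith
    have hx := hδ _ ⟨by positivity, hx1⟩
    set ρ := Real.log (1 + Real.exp (-(δ ((j : ℝ) / n)))) with hρ_def
    have hρ : 0 < ρ := Real.log_pos (by linarith [Real.exp_pos (-(δ ((j : ℝ) / n)))])
    have hexp : Real.exp ρ = 1 + Real.exp (-(δ ((j : ℝ) / n))) :=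
      Real.exp_log (by positivity)
    have hsaddle : j * ρ * Real.exp ρ = n * (Real.exp ρ - 1) := by
      have hinv : Real.exp (δ ((j : ℝ) / n)) * Real.exp (-(δ ((j : ℝ) / n))) = 1 := by
        rw [← Real.exp_add, add_neg_cancel, Real.exp_zero]
      have hx' : (1 + Real.exp (δ ((j : ℝ) / n))) * ρ * j = n := by
        rw [hx]; field_simp
      rw [hexp]
      linear_combination Real.exp (-(δ ((j : ℝ) / n))) * hx' - j * ρ * hinv
    rw [div_lt_one hn0] at hx1
    rw [le_div_iff₀ hn0] at h1
    rw [div_le_iff₀ hn0] at h2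
    obtain ⟨m, rfl⟩ := Nat.exists_eq_add_of_le hjn
    have hm : 1 ≤ m := by
      rw [Nat.cast_lt] at hx1
      omega
    have hphi := phi_pow δ hj hm hρ hρ_def.symm
    have hm0 : (0 : ℝ) < m := by positivity
    have hP : 0 < ρ ^ (j + m) * ((j : ℝ) ^ j * (m : ℝ) ^ m) := by positivity
    have hb0 := surjCoeff_nonneg (j + m) j
    have hE : 0 ≤ Real.exp ρ - 1 := by linarith [Real.add_one_le_exp ρ]
    rw [a_eq]
    constructor
    · refine le_of_mul_le_mul_right ?_ hP
      have hsqrt : 3 / 10 * ((j + m : ℕ) : ℝ) ≤ Real.sqrt j * Real.sqrt m := by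
        rw [← Real.sqrt_mul hj0.le]
        refine Real.le_sqrt_of_sq_le ?_
        push_cast at h1 h2 ⊢
        nlinarith
      have hC := choose_mul_factorial_le hj hm (by norm_num) hsqrt
      have hb := surjCoeff_mul_pow_le hρ.le (j + m) j
      have := mul_le_mul hC hb (by positivity) (by positivity)
      refine le_trans (le_of_eq ?_) (this.trans (le_of_eq ?_))
      · ring
      · linear_combination -30 * hphi
    · refine le_of_mul_le_mul_right ?_ hP
      have hC := le_choose_mul_factorial hj hm
      have hb := saddle_le_surjCoeff hρ hj hjn hsaddle
      have hs : 0 < Real.sqrt ((j + m : ℕ) : ℝ) := Real.sqrt_pos.2 hn0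
      have h3 := mul_le_mul hC hb (by positivity) (by positivity)
      rw [← hphi] at h3
      have h4 := mul_le_mul_of_nonneg_left h3
        (show 0 ≤ 1 / 108 / Real.sqrt ((j + m : ℕ) : ℝ) by positivity)
      refine le_trans (le_of_eq ?_) (h4.trans (le_of_eq ?_))
      · ring
      · field_simp
        ring
end

section
/- For any real number r with 0 < r < 1/2, there exist positive constants c1 and C1 such that for every pair of positive integers n, j with r ≤ j/n ≤ 1−r, the Stirling number of the second kind satisfies (e^{−1/12}·c1/√(2πn))·(n^{1−j/n}·ψ(j/n))^n ≤ S(n,j) ≤ (e^{1/12}·C1/√(2πn))·(n^{1−j/n}·ψ(j/n))^n. -/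
noncomputable def psi (δ : ℝ → ℝ) (x : ℝ) : ℝ :=
  Real.exp (-((1 - x) + x * δ x)) / (x ^ x * Real.log (1 + Real.exp (-(δ x))))

open Real Finset MeasureTheory

/-- The recursion of the Stirling numbers of the second kind. -/
lemma stirling2_succ_succ (n j : ℕ) :
    stirling2 (n + 1) (j + 1) = (j + 1) * stirling2 n (j + 1) + stirling2 n j := by
  have key : ∑ i ∈ range (j + 1 + 1),
        (-1 : ℝ) ^ i * (Nat.choose (j + 1) i : ℝ) * ((j + 1 - i : ℕ) : ℝ) ^ (n + 1) =
      (j + 1) * ∑ i ∈ range (j + 1 + 1),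
        (-1 : ℝ) ^ i * (Nat.choose (j + 1) i : ℝ) * ((j + 1 - i : ℕ) : ℝ) ^ n +
      (j + 1) * ∑ i ∈ range (j + 1),
        (-1 : ℝ) ^ i * (Nat.choose j i : ℝ) * ((j - i : ℕ) : ℝ) ^ n := by
    rw [sum_range_succ', sum_range_succ' _ (j + 1), mul_add, mul_sum, mul_sum, add_right_comm,
      ← sum_add_distrib]
    congr 1
    · refine sum_congr rfl fun i hi => ?_
      have hij : i ≤ j := Nat.lt_succ_iff.mp (mem_range.mp hi)
      have hc : ((j : ℝ) + 1) * (Nat.choose j i : ℝ) =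
          (Nat.choose (j + 1) (i + 1) : ℝ) * (i + 1) := by
        exact_mod_cast Nat.add_one_mul_choose_eq j i
      rw [Nat.add_sub_add_right, pow_succ (((j - i : ℕ) : ℝ)), Nat.cast_sub hij]
      linear_combination ((-1 : ℝ) ^ (i + 1) * ((j : ℝ) - i) ^ n) * hc
    · simp
      ring
  have hf : ((j + 1).factorial : ℝ) = (j + 1) * (j.factorial : ℝ) := by
    push_cast [Nat.factorial_succ]; ring
  have hj : (j.factorial : ℝ) ≠ 0 := by positivity
  have hj' : (j : ℝ) + 1 ≠ 0 := by positivity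
  unfold stirling2
  rw [key, hf]
  field_simp

lemma stirling2_nonneg (n j : ℕ) : 0 ≤ stirling2 n j := by
  induction n generalizing j with
  | zero =>
    have h : stirling2 0 j = (1 / (j.factorial : ℝ)) * (if j = 0 then 1 else 0) := by
      have := Int.alternating_sum_range_choose (n := j)
      have h2 : ∑ i ∈ range (j + 1), (-1 : ℝ) ^ i * (Nat.choose j i : ℝ) =
          if j = 0 then 1 else 0 := by exact_mod_cast this
      simp [stirling2, h2]
    rw [h]
    positivity
  | succ n ih =>
    cases j with
    | zero => simp [stirling2]
    | succ j =>
      rw [stirling2_succ_succ]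
      have := ih j
      have := ih (j + 1)
      positivity

lemma stirling2_self (n : ℕ) : 0 < stirling2 n n := by
  induction n with
  | zero => simp [stirling2]
  | succ n ih =>
    rw [stirling2_succ_succ]
    have := stirling2_nonneg n (n + 1)
    positivity

lemma stirling2_pos {n j : ℕ} (hj : 0 < j) (hjn : j ≤ n) : 0 < stirling2 n j := by
  induction n, hjn using Nat.le_induction with
  | base => exact stirling2_self j
  | succ n hn ih =>
    obtain ⟨k, rfl⟩ := Nat.exists_eq_add_one.mpr hj
    rw [stirling2_succ_succ]
    have := stirling2_nonneg n k
    positivity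

/-- The Stirling numbers of the second kind as Taylor coefficients of `(e ^ z - 1) ^ j / j!`. -/
lemma iteratedDeriv_exp_sub_one_pow (n j : ℕ) :
    iteratedDeriv n (fun z : ℂ => (Complex.exp z - 1) ^ j) 0 =
      (j.factorial : ℂ) * (stirling2 n j : ℂ) := by
  have h1 : (fun z : ℂ => (Complex.exp z - 1) ^ j) = fun z => ∑ i ∈ range (j + 1),
      ((-1 : ℂ) ^ i * (Nat.choose j i : ℂ)) * Complex.exp (((j - i : ℕ) : ℂ) * z) := by
    funext z
    rw [sub_eq_neg_add, add_pow]
    refine sum_congr rfl fun i _ => ?_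
    rw [Complex.exp_nat_mul]
    ring
  rw [h1, iteratedDeriv_fun_sum fun i _ => by fun_prop]
  have hj : (j.factorial : ℂ) ≠ 0 := by exact_mod_cast j.factorial_ne_zero
  simp only [stirling2]
  push_cast
  rw [← mul_assoc, mul_one_div_cancel hj, one_mul]
  refine sum_congr rfl fun i _ => ?_
  rw [iteratedDeriv_const_mul_field, iteratedDeriv_cexp_const_mul]
  simp

/-- Cauchy's formula for the Stirling numbers of the second kind. -/
lemma integral_exp_sub_one_pow (n j : ℕ) {R : ℝ} (hR : 0 < R) :
    ∫ θ in (-π)..π, (Complex.exp (R * Complex.exp (θ * Complex.I)) - 1) ^ j *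
        Complex.exp (-(n * θ * Complex.I)) =
      ((2 * π * R ^ n * (j.factorial * stirling2 n j / n.factorial) : ℝ) : ℂ) := by
  have hd : DifferentiableOn ℂ (fun z : ℂ => (Complex.exp z - 1) ^ j) (Metric.closedBall 0 R) := by
    fun_prop
  have h := hd.circleIntegral_one_div_sub_center_pow_smul hR n
  rw [iteratedDeriv_exp_sub_one_pow, circleIntegral] at h
  set f : ℝ → ℂ := fun θ => (Complex.exp (R * Complex.exp (θ * Complex.I)) - 1) ^ j *
        Complex.exp (-(n * θ * Complex.I)) with hf
  have hR' : (R : ℂ) ≠ 0 := by exact_mod_cast hR.ne'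
  have h2 : ∀ θ : ℝ, deriv (circleMap 0 R) θ • ((1 / (circleMap 0 R θ - 0) ^ (n + 1)) •
      (Complex.exp (circleMap 0 R θ) - 1) ^ j) = (Complex.I / (R : ℂ) ^ n) * f θ := by
    intro θ
    simp only [deriv_circleMap, circleMap, zero_add, sub_zero, smul_eq_mul, hf, mul_pow]
    have he : Complex.exp (θ * Complex.I) ≠ 0 := Complex.exp_ne_zero _
    rw [Complex.exp_neg, mul_assoc (n : ℂ), Complex.exp_nat_mul]
    field_simp
    ring
  have hper : Function.Periodic f (2 * π) := by
    intro θ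
    simp only [hf]
    congr 1
    · congr 3
      push_cast
      rw [add_mul, Complex.exp_add, Complex.exp_two_pi_mul_I, mul_one]
    · have : -((n : ℂ) * ((θ + 2 * π : ℝ) : ℂ) * Complex.I) =
          -(n * θ * Complex.I) - n * (2 * π * Complex.I) := by push_cast; ring
      rw [this, Complex.exp_sub, Complex.exp_nat_mul, Complex.exp_two_pi_mul_I]
      simp
  have h3 := hper.intervalIntegral_add_eq 0 (-π)
  have h4 : -π + 2 * π = π := by ring
  rw [zero_add, h4] at h3
  rw [← h3]
  simp_rw [h2] at h
  rw [intervalIntegral.integral_const_mul] at h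
  have hI := Complex.I_ne_zero
  have hn : (n.factorial : ℂ) ≠ 0 := by exact_mod_cast n.factorial_ne_zero
  push_cast
  field_simp at h ⊢
  rw [smul_eq_mul] at h
  field_simp at h
  linear_combination h

/-- The characteristic function of the Poisson distribution of parameter `R` conditioned to be
positive. -/
noncomputable def truncPoissonChar (R θ : ℝ) : ℂ :=
  (Complex.exp (R * Complex.exp (θ * Complex.I)) - 1) / (Complex.exp R - 1)

lemma continuous_truncPoissonChar (R : ℝ) : Continuous (truncPoissonChar R) := by
  unfold truncPoissonChar
  fun_prop

lemma norm_exp_sub_one_le {R θ : ℝ} (hR : 0 < R) (hθ : |θ| ≤ π) :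
    ‖Complex.exp (R * Complex.exp (θ * Complex.I)) - 1‖ ≤
      (exp R - 1) - R ^ 2 / (2 + R) * (2 / π ^ 2) * θ ^ 2 := by
  set w : ℂ := R * Complex.exp (θ * Complex.I) with hw
  have hwn : ‖w‖ = R := by
    rw [hw, norm_mul, Complex.norm_exp_ofReal_mul_I, Complex.norm_real, mul_one,
      Real.norm_of_nonneg hR.le]
  have h1 := Complex.norm_exp_sub_sum_le_exp_norm_sub_sum w 3
  simp only [sum_range_succ, sum_range_zero, hwn] at h1
  norm_num [Nat.factorial] at h1
  have h2 : ‖w + w ^ 2 / 2‖ ≤ R + R ^ 2 / 2 - R ^ 2 / (2 + R) * (1 - cos θ) := by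
    have e : w + w ^ 2 / 2 = w * (1 + w / 2) := by ring
    have hre : w.re = R * cos θ := by
      simp [hw, Complex.exp_ofReal_mul_I_re]
    have him : w.im = R * sin θ := by
      simp [hw, Complex.exp_ofReal_mul_I_im]
    have h3 : ‖1 + w / 2‖ ≤ 1 + R / 2 - R / (2 + R) * (1 - cos θ) := by
      have hc := neg_one_le_cos θ
      have hq : R / (2 + R) * (1 - cos θ) ≤ R / (2 + R) * 2 := by
        gcongr; linarith
      have hq2 : R / (2 + R) * 2 ≤ 1 + R / 2 := by
        rw [div_mul_eq_mul_div, div_le_iff₀ (by positivity)]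
        nlinarith
      refine abs_le_of_sq_le_sq' ?_ (by linarith) |>.2
      have e2 : ‖1 + w / 2‖ ^ 2 = (1 + R / 2) ^ 2 - R * (1 - cos θ) := by
        rw [← Complex.normSq_eq_norm_sq, Complex.normSq_apply]
        have := sin_sq_add_cos_sq θ
        simp [hre, him]
        linear_combination R ^ 2 / 4 * this
      rw [e2]
      have e3 : (1 + R / 2 - R / (2 + R) * (1 - cos θ)) ^ 2 =
          (1 + R / 2) ^ 2 - R * (1 - cos θ) + (R / (2 + R) * (1 - cos θ)) ^ 2 := by
        field_simp
        ring
      rw [e3]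
      linarith [sq_nonneg (R / (2 + R) * (1 - cos θ))]
    rw [e, norm_mul, hwn]
    calc R * ‖1 + w / 2‖ ≤ R * (1 + R / 2 - R / (2 + R) * (1 - cos θ)) := by gcongr
      _ = _ := by ring
  have h4 := cos_le_one_sub_mul_cos_sq hθ
  have h5 : R ^ 2 / (2 + R) * (2 / π ^ 2 * θ ^ 2) ≤ R ^ 2 / (2 + R) * (1 - cos θ) := by
    gcongr
    linarith
  have h6 : Complex.exp w - 1 = (Complex.exp w - (1 + w + w ^ 2 / 2)) + (w + w ^ 2 / 2) := by ring
  rw [h6]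
  refine (norm_add_le _ _).trans ?_
  linarith

/-- A Gaussian bound for the characteristic function, uniform for parameters in a compact set. -/
lemma exists_norm_truncPoissonChar_le {r B : ℝ} (hr : 0 < r) (hB : 0 < B) :
    ∃ κ > 0, ∀ R θ : ℝ, r ≤ R → R ≤ B → |θ| ≤ π →
      ‖truncPoissonChar R θ‖ ≤ exp (-κ * θ ^ 2) := by
  refine ⟨r ^ 2 / (2 + B) * (2 / π ^ 2) / exp B, by positivity, fun R θ h1 h2 hθ => ?_⟩
  have hR : 0 < R := hr.trans_le h1
  have he : 0 < exp R - 1 := by linarith [add_one_le_exp R]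
  have hn : ‖Complex.exp R - 1‖ = exp R - 1 := by
    rw [← Complex.ofReal_exp, ← Complex.ofReal_one, ← Complex.ofReal_sub, Complex.norm_real,
      Real.norm_of_nonneg he.le]
  rw [truncPoissonChar, norm_div, hn, div_le_iff₀ he]
  refine (norm_exp_sub_one_le hR hθ).trans ?_
  have h3 : r ^ 2 / (2 + B) * (2 / π ^ 2) / exp B * (exp R - 1) ≤
      R ^ 2 / (2 + R) * (2 / π ^ 2) := by
    have : exp R - 1 ≤ exp B := by linarith [exp_le_exp.mpr h2]
    calc _ ≤ r ^ 2 / (2 + B) * (2 / π ^ 2) / exp B * exp B := by gcongr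
      _ = r ^ 2 / (2 + B) * (2 / π ^ 2) := by field_simp
      _ ≤ _ := by gcongr
  have h4 := add_one_le_exp (-(r ^ 2 / (2 + B) * (2 / π ^ 2) / exp B) * θ ^ 2)
  nlinarith [mul_le_mul_of_nonneg_right h3 (sq_nonneg θ), mul_le_mul_of_nonneg_right h4 he.le]

lemma norm_exp_poisson_sub_le {B R m θ : ℝ} (hB : 0 ≤ B) (hR : 0 ≤ R) (hRB : R ≤ B) (hm : 0 ≤ m)
    (hmB : m ≤ B) (hθ : |θ| ≤ 1) :
    ‖Complex.exp (R * (Complex.exp (θ * Complex.I) - 1) - m * (θ * Complex.I)) -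
      (1 + (R - m) * (θ * Complex.I) + (R + (R - m) ^ 2) * (θ * Complex.I) ^ 2 / 2)‖ ≤
      (216 * B ^ 3 * exp (6 * B) + 3 * B + 14 * B ^ 2) * |θ| ^ 3 := by
  set w : ℂ := θ * Complex.I with hw
  have hwn : ‖w‖ = |θ| := by simp [hw]
  set t := |θ| with ht
  have ht0 : 0 ≤ t := abs_nonneg θ
  set E : ℂ := Complex.exp w - (1 + w + w ^ 2 / 2) with hE
  have hEn : ‖E‖ ≤ 3 * t ^ 3 := by
    have h1 := Complex.norm_exp_sub_sum_le_norm_mul_exp w 3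
    simp only [sum_range_succ, sum_range_zero, hwn] at h1
    norm_num [Nat.factorial] at h1
    have h2 : exp t ≤ 3 := (exp_le_exp.mpr hθ).trans (by linarith [exp_one_lt_d9])
    calc ‖E‖ ≤ t ^ 3 * exp t := h1
      _ ≤ t ^ 3 * 3 := by gcongr
      _ = _ := by ring
  have ht2 : t ^ 2 ≤ t := by nlinarith
  have ht3 : t ^ 3 ≤ t ^ 2 := by nlinarith [sq_nonneg t]
  have hRm : ‖((R : ℂ) - m) * w‖ ≤ B * t := by
    rw [norm_mul, hwn, ← Complex.ofReal_sub, Complex.norm_real, Real.norm_eq_abs]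
    gcongr
    rw [abs_le]
    constructor <;> linarith
  have hRn : ‖(R : ℂ)‖ ≤ B := by rwa [Complex.norm_real, Real.norm_of_nonneg hR]
  set D : ℂ := R * (w ^ 2 / 2 + E) with hD
  have hDn : ‖D‖ ≤ 4 * B * t ^ 2 := by
    rw [hD, norm_mul]
    have : ‖w ^ 2 / 2 + E‖ ≤ 4 * t ^ 2 := by
      refine (norm_add_le _ _).trans ?_
      rw [norm_div, norm_pow, hwn, Complex.norm_ofNat]
      nlinarith
    calc ‖(R : ℂ)‖ * ‖w ^ 2 / 2 + E‖ ≤ B * (4 * t ^ 2) := by gcongr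
      _ = _ := by ring
  set u : ℂ := R * (Complex.exp w - 1) - m * w with hu
  have hu' : u = (R - m) * w + D := by rw [hu, hD, hE]; ring
  have hBt : B * t ^ 2 ≤ B * t := by gcongr
  have hun : ‖u‖ ≤ 6 * B * t := by
    rw [hu']
    refine (norm_add_le _ _).trans ?_
    nlinarith
  have hun2 : ‖u + (R - m) * w‖ ≤ 7 * B * t := by
    refine (norm_add_le _ _).trans ?_
    linarith
  have hexp : ‖Complex.exp u - (1 + u + u ^ 2 / 2)‖ ≤ 216 * B ^ 3 * exp (6 * B) * t ^ 3 := by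
    have h1 := Complex.norm_exp_sub_sum_le_norm_mul_exp u 3
    simp only [sum_range_succ, sum_range_zero] at h1
    norm_num [Nat.factorial] at h1
    have h6 : 6 * B * t ≤ 6 * B := by nlinarith
    calc _ ≤ ‖u‖ ^ 3 * exp ‖u‖ := h1
      _ ≤ (6 * B * t) ^ 3 * exp (6 * B) := by
        gcongr
        exact hun.trans h6
      _ = _ := by ring
  have hdec : Complex.exp u - (1 + (R - m) * w + (R + (R - m) ^ 2) * w ^ 2 / 2) =
      (Complex.exp u - (1 + u + u ^ 2 / 2)) + R * E + D * (u + (R - m) * w) / 2 := by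
    rw [hu', hD]
    ring
  rw [hdec]
  refine (norm_add₃_le).trans ?_
  have hRE : ‖(R : ℂ) * E‖ ≤ B * (3 * t ^ 3) := by
    rw [norm_mul]; gcongr
  have hDu : ‖D * (u + (R - m) * w) / 2‖ ≤ (4 * B * t ^ 2) * (7 * B * t) / 2 := by
    rw [norm_div, norm_mul, Complex.norm_ofNat]; gcongr
  linarith

lemma norm_pow_sub_pow_le_mul {a b : ℂ} (ha : ‖a‖ ≤ 1) (hb : ‖b‖ ≤ 1) (j : ℕ) :
    ‖a ^ j - b ^ j‖ ≤ j * ‖a - b‖ := by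
  induction j with
  | zero => simp
  | succ j ih =>
    have h : a ^ (j + 1) - b ^ (j + 1) = a ^ j * (a - b) + (a ^ j - b ^ j) * b := by ring
    rw [h]
    refine (norm_add_le _ _).trans ?_
    rw [norm_mul, norm_mul, norm_pow]
    have h1 : ‖a‖ ^ j ≤ 1 := pow_le_one₀ (norm_nonneg _) ha
    have h2 : ‖a‖ ^ j * ‖a - b‖ ≤ 1 * ‖a - b‖ := by gcongr
    have h3 : ‖a ^ j - b ^ j‖ * ‖b‖ ≤ j * ‖a - b‖ * 1 := by gcongr
    push_cast
    linarith

/-- The centred characteristic function is close to a Gaussian near the origin. -/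
lemma exists_norm_truncPoissonChar_sub_le {r B : ℝ} (hr : 0 < r) (hB : 0 < B) :
    ∃ C > 0, ∀ R m θ : ℝ, r ≤ R → R ≤ B → 0 ≤ m → m ≤ B → m ≤ 1 + R →
      R * exp R = m * (exp R - 1) → |θ| ≤ 1 →
      ‖truncPoissonChar R θ * Complex.exp (-(m * (θ * Complex.I))) -
        (exp (-(m * (1 + R - m) / 2 * θ ^ 2)) : ℝ)‖ ≤ C * |θ| ^ 3 := by
  set K := 216 * B ^ 3 * exp (6 * B) + 3 * B + 14 * B ^ 2 with hK
  set V := B * (1 + B) with hV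
  have hK0 : 0 < K := by positivity
  refine ⟨(exp B * K + K) / r + V ^ 2 * exp V, by positivity,
    fun R m θ h1 h2 hm hmB hmR hs hθ => ?_⟩
  have hR : 0 < R := hr.trans_le h1
  have he : r ≤ exp R - 1 := by linarith [add_one_le_exp R]
  have he0 : 0 < exp R - 1 := hr.trans_le he
  have hn : ‖Complex.exp R - 1‖ = exp R - 1 := by
    rw [← Complex.ofReal_exp, ← Complex.ofReal_one, ← Complex.ofReal_sub, Complex.norm_real,
      Real.norm_of_nonneg he0.le]
  have hne : Complex.exp R - 1 ≠ 0 := by rw [← norm_ne_zero_iff, hn]; exact he0.ne'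
  have T1 := norm_exp_poisson_sub_le hB.le hR.le h2 hm hmB hθ
  have T2 := norm_exp_poisson_sub_le hB.le le_rfl hB.le hm hmB hθ
  rw [← hK] at T1 T2
  set w : ℂ := θ * Complex.I with hw
  have hw2 : w ^ 2 = -(θ : ℂ) ^ 2 := by rw [hw, mul_pow, Complex.I_sq]; ring
  set P1 : ℂ := 1 + (R - m) * w + (R + (R - m) ^ 2) * w ^ 2 / 2 with hP1
  set P2 : ℂ := 1 + ((0 : ℝ) - m) * w + ((0 : ℝ) + ((0 : ℝ) - m) ^ 2) * w ^ 2 / 2 with hP2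
  set X1 := Complex.exp (R * (Complex.exp w - 1) - m * w) with hX1
  set X2 := Complex.exp ((0 : ℝ) * (Complex.exp w - 1) - m * w) with hX2
  set v := m * (1 + R - m) with hv
  have hv0 : 0 ≤ v := mul_nonneg hm (by linarith)
  have hvV : v ≤ V := by
    rw [hv, hV]; gcongr; linarith
  have hsC : (R : ℂ) * Complex.exp R = m * (Complex.exp R - 1) := by exact_mod_cast hs
  have e1 : truncPoissonChar R θ * Complex.exp (-(m * w)) =
      (Complex.exp R * X1 - X2) / (Complex.exp R - 1) := by
    have f1 : Complex.exp R * X1 =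
        Complex.exp (R * Complex.exp w) * Complex.exp (-(m * w)) := by
      rw [hX1, ← Complex.exp_add, ← Complex.exp_add]; congr 1; ring
    have f2 : X2 = Complex.exp (-(m * w)) := by
      rw [hX2]; congr 1; push_cast; ring
    rw [truncPoissonChar, ← hw, f1, f2, div_mul_eq_mul_div, sub_one_mul]
  have e2 : (1 - v / 2 * θ ^ 2 : ℂ) = (Complex.exp R * P1 - P2) / (Complex.exp R - 1) := by
    rw [eq_div_iff hne, hP1, hP2, hw2, hv]
    push_cast
    linear_combination (-w + ((θ : ℂ) ^ 2 / 2) * (1 + R - 2 * m)) * hsC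
  have b1 : ‖truncPoissonChar R θ * Complex.exp (-(m * w)) - (1 - v / 2 * θ ^ 2 : ℂ)‖ ≤
      (exp B * K + K) / r * |θ| ^ 3 := by
    have : (Complex.exp R * X1 - X2) - (Complex.exp R * P1 - P2) =
      Complex.exp R * (X1 - P1) - (X2 - P2) := by ring
    rw [e1, e2, ← sub_div, norm_div, hn, this, div_mul_eq_mul_div]
    gcongr
    refine (norm_sub_le _ _).trans ?_
    rw [norm_mul, ← Complex.ofReal_exp, Complex.norm_real, Real.norm_of_nonneg (exp_pos R).le,
      add_mul, mul_assoc]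
    gcongr
  have b2 : ‖(1 - v / 2 * θ ^ 2 : ℂ) - (exp (-(v / 2 * θ ^ 2)) : ℝ)‖ ≤
      V ^ 2 * exp V * |θ| ^ 3 := by
    have h := Complex.norm_exp_sub_sum_le_norm_mul_exp (-(v / 2 * θ ^ 2) : ℝ) 2
    simp only [sum_range_succ, sum_range_zero] at h
    norm_num at h
    rw [norm_sub_rev]
    have h3 : |θ| ^ 2 ≤ 1 := pow_le_one₀ (abs_nonneg θ) hθ
    have h4 : |v| / 2 * θ ^ 2 ≤ V * |θ| ^ 2 := by
      rw [abs_of_nonneg hv0, sq_abs]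
      gcongr
      linarith
    have h5 : V * |θ| ^ 2 ≤ V := mul_le_of_le_one_right (by positivity) h3
    have h6 : (exp (-(v / 2 * θ ^ 2)) : ℂ) - (1 - v / 2 * θ ^ 2 : ℂ) =
      Complex.exp (-(v / 2 * θ ^ 2)) - (1 + -(v / 2 * θ ^ 2)) := by push_cast; ring
    rw [h6]
    calc _ ≤ (|v| / 2 * θ ^ 2) ^ 2 * exp (|v| / 2 * θ ^ 2) := h
      _ ≤ (V * |θ| ^ 2) ^ 2 * exp V := by
        gcongr
        exact h4.trans h5
      _ = V ^ 2 * exp V * |θ| ^ 3 * |θ| := by ring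
      _ ≤ _ := mul_le_of_le_one_right (by positivity) hθ
  refine (norm_sub_le_norm_sub_add_norm_sub _ (1 - v / 2 * θ ^ 2 : ℂ) _).trans ?_
  rw [add_mul]
  exact add_le_add b1 b2

lemma integral_gaussian_Icc_le {b : ℝ} (hb : 0 < b) :
    ∫ θ in (-π)..π, exp (-b * θ ^ 2) ≤ √(π / b) := by
  rw [intervalIntegral.integral_of_le (by linarith [pi_pos]), ← integral_gaussian]
  exact setIntegral_le_integral (integrable_exp_neg_mul_sq hb)
    (Filter.Eventually.of_forall fun θ => (exp_pos _).le)

lemma le_integral_gaussian_Icc {W : ℝ} (hW : 0 ≤ W) {n : ℕ} (hn : 0 < n) :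
    2 * exp (-W) / √n ≤ ∫ θ in (-π)..π, exp (-W * n * θ ^ 2) := by
  have hs : 0 < √(n : ℝ) := by positivity
  have hn1 : 1 ≤ √(n : ℝ) := by rw [one_le_sqrt]; exact_mod_cast hn
  have hpi : 1 / √(n : ℝ) ≤ π := by
    rw [div_le_iff₀ hs]
    nlinarith [pi_gt_three]
  have h0 : 0 < 1 / √(n : ℝ) := by positivity
  have hc : Continuous fun θ : ℝ => exp (-W * n * θ ^ 2) := by fun_prop
  calc 2 * exp (-W) / √n = ∫ _ in (-(1 / √(n : ℝ)))..(1 / √(n : ℝ)), exp (-W) := by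
        rw [intervalIntegral.integral_const, smul_eq_mul]; ring
    _ ≤ ∫ θ in (-(1 / √(n : ℝ)))..(1 / √(n : ℝ)), exp (-W * n * θ ^ 2) := by
        refine intervalIntegral.integral_mono_on (by linarith) (by simp)
          (hc.intervalIntegrable _ _) fun θ hθ => ?_
        have h1 : θ ^ 2 ≤ (1 / √(n : ℝ)) ^ 2 := sq_le_sq' hθ.1 hθ.2
        rw [div_pow, sq_sqrt (Nat.cast_nonneg n), one_pow, le_div_iff₀ (by positivity)] at h1
        apply exp_le_exp.mpr
        nlinarith
    _ ≤ _ := by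
        refine intervalIntegral.integral_mono_interval (by linarith) (by linarith) hpi
          (Filter.Eventually.of_forall fun θ => (exp_pos _).le) (hc.intervalIntegrable _ _)

/-- Laplace's method: a function which is nearly bounded below by a Gaussian close to the origin,
and has a Gaussian tail, has integral of order at least `1 / √n`. -/
lemma exists_le_integral_of_gaussian_approx {k W C : ℝ} (hk : 0 < k) (hkW : k ≤ W) (hC : 0 < C) :
    ∃ N : ℕ, ∀ n : ℕ, N ≤ n → 0 < n → ∀ F : ℝ → ℝ, Continuous F →
      (∀ θ, |θ| ≤ π → -exp (-k * n * θ ^ 2) ≤ F θ) →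
      (∀ θ, |θ| ≤ 1 → exp (-W * n * θ ^ 2) - C * n * |θ| ^ 3 ≤ F θ) →
      exp (-W) / √n ≤ ∫ θ in (-π)..π, F θ := by
  have hW : 0 < W := hk.trans_le hkW
  obtain ⟨A, hA1, hA⟩ : ∃ A : ℝ, 1 ≤ A ∧
      2 * exp (-(k / 2) * A ^ 2) * √(π / (k / 2)) ≤ exp (-W) / 2 := by
    have h1 : Filter.Tendsto (fun A : ℝ => 2 * exp (-((k / 2) * A ^ 2)) * √(π / (k / 2)))
        Filter.atTop (nhds (2 * 0 * √(π / (k / 2)))) := by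
      refine ((Filter.Tendsto.const_mul 2 ?_).mul_const _)
      refine tendsto_exp_neg_atTop_nhds_zero.comp ?_
      exact (Filter.tendsto_pow_atTop two_ne_zero).const_mul_atTop (by positivity)
    rw [mul_zero, zero_mul] at h1
    obtain ⟨A, h2, h3⟩ := ((h1.eventually_le_const (u := exp (-W) / 2) (by positivity)).and
      (Filter.eventually_ge_atTop 1)).exists
    exact ⟨A, h3, by simpa only [neg_mul] using h2⟩
  have hA0 : 0 < A := by linarith
  obtain ⟨N, hN⟩ := exists_nat_ge
    (max (A ^ 2) ((C * A ^ 3 * exp (A ^ 2) * √π / (exp (-W) / 2)) ^ 2))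
  refine ⟨N, fun n hn hn0 F hF h1 h2 => ?_⟩
  have hnN : (N : ℝ) ≤ n := by exact_mod_cast hn
  have hnA : A ^ 2 ≤ n := (le_max_left _ _).trans (hN.trans hnN)
  have hnr : (0 : ℝ) < n := by exact_mod_cast hn0
  have hs : 0 < √(n : ℝ) := by positivity
  have hss : √(n : ℝ) ^ 2 = n := sq_sqrt hnr.le
  have hnB : C * A ^ 3 * exp (A ^ 2) * √π ≤ exp (-W) / 2 * √n := by
    rw [← div_le_iff₀' (by positivity)]
    exact le_sqrt_of_sq_le ((le_max_right _ _).trans (hN.trans hnN))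
  have hpt : ∀ θ ∈ Set.Icc (-π) π, exp (-W * n * θ ^ 2) -
      C * A ^ 3 * exp (A ^ 2) / √n * exp (-n * θ ^ 2) -
      2 * exp (-(k / 2) * A ^ 2) * exp (-(k / 2 * n) * θ ^ 2) ≤ F θ := by
    intro θ hθ
    by_cases hθA : n * θ ^ 2 ≤ A ^ 2
    · have hsq : (|θ| * √n) ^ 2 ≤ A ^ 2 := by
        rw [mul_pow, sq_abs, hss]
        linarith
      have hle : |θ| * √n ≤ A := (abs_le_of_sq_le_sq' hsq hA0.le).2
      have hθ1 : |θ| ≤ 1 := by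
        rw [← abs_one, ← sq_le_sq, one_pow]
        by_contra! h
        nlinarith
      have h3 : C * n * |θ| ^ 3 ≤ C * A ^ 3 * exp (A ^ 2) / √n * exp (-n * θ ^ 2) := by
        have h4 : 1 ≤ exp (A ^ 2) * exp (-n * θ ^ 2) := by
          rw [← exp_add]; exact one_le_exp (by linarith)
        have h5 : C * n * |θ| ^ 3 * √n ≤ C * A ^ 3 := by
          have : (|θ| * √n) ^ 3 ≤ A ^ 3 := by gcongr
          calc C * n * |θ| ^ 3 * √n = C * (|θ| * √n) ^ 3 := by
                rw [mul_pow, pow_succ (√(n : ℝ)), hss]; ring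
            _ ≤ _ := by gcongr
        rw [div_mul_eq_mul_div, le_div_iff₀ hs, mul_assoc _ (exp _)]
        refine h5.trans (le_mul_of_one_le_right (by positivity) h4)
      have := h2 θ hθ1
      have : 0 ≤ 2 * exp (-(k / 2) * A ^ 2) * exp (-(k / 2 * n) * θ ^ 2) := by positivity
      linarith
    · push Not at hθA
      have h3 := h1 θ (abs_le.mpr hθ)
      have h4 : exp (-W * n * θ ^ 2) ≤ exp (-k * n * θ ^ 2) := by
        apply exp_le_exp.mpr
        have : k * (n * θ ^ 2) ≤ W * (n * θ ^ 2) := by gcongr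
        linarith
      have h5 : exp (-k * n * θ ^ 2) ≤
          exp (-(k / 2) * A ^ 2) * exp (-(k / 2 * n) * θ ^ 2) := by
        rw [← exp_add]
        apply exp_le_exp.mpr
        nlinarith
      have : 0 ≤ C * A ^ 3 * exp (A ^ 2) / √n * exp (-n * θ ^ 2) := by positivity
      linarith
  have hint : ∀ b : ℝ, IntervalIntegrable (fun θ : ℝ => exp (b * θ ^ 2)) volume (-π) π :=
    fun b => Continuous.intervalIntegrable (by fun_prop) _ _
  have hI := intervalIntegral.integral_mono_on (by linarith [pi_pos])
    (((hint (-W * n)).sub ((hint (-n)).const_mul _)).sub ((hint (-(k / 2 * n))).const_mul _))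
    (hF.intervalIntegrable (-π) π) hpt
  rw [intervalIntegral.integral_sub ((hint (-W * n)).sub ((hint (-n)).const_mul _))
    ((hint (-(k / 2 * n))).const_mul _), intervalIntegral.integral_sub (hint (-W * n))
    ((hint (-n)).const_mul _), intervalIntegral.integral_const_mul,
    intervalIntegral.integral_const_mul] at hI
  have g1 := le_integral_gaussian_Icc hW.le hn0
  have g2 := integral_gaussian_Icc_le hnr
  have g3 := integral_gaussian_Icc_le (b := k / 2 * n) (by positivity)
  rw [sqrt_div pi_pos.le] at g2
  rw [← div_div, sqrt_div (by positivity)] at g3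
  have g2' : C * A ^ 3 * exp (A ^ 2) / √n * ∫ θ in (-π)..π, exp (-n * θ ^ 2) ≤
      exp (-W) / 2 / √n := by
    calc _ ≤ C * A ^ 3 * exp (A ^ 2) / √n * (√π / √n) := by gcongr
      _ = C * A ^ 3 * exp (A ^ 2) * √π / √n / √n := by ring
      _ ≤ (exp (-W) / 2 * √n) / √n / √n := by gcongr
      _ = _ := by field_simp
  have g3' : 2 * exp (-(k / 2) * A ^ 2) * ∫ θ in (-π)..π, exp (-(k / 2 * n) * θ ^ 2) ≤
      exp (-W) / 2 / √n := by
    calc _ ≤ 2 * exp (-(k / 2) * A ^ 2) * (√(π / (k / 2)) / √n) := by gcongr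
      _ = 2 * exp (-(k / 2) * A ^ 2) * √(π / (k / 2)) / √n := by ring
      _ ≤ _ := by gcongr
  have e : exp (-W) / √n = 2 * exp (-W) / √n - exp (-W) / 2 / √n - exp (-W) / 2 / √n := by ring
  linarith

/-- A local limit theorem, up to constants: the integral governing the Stirling numbers has order
`1 / √n`. -/
lemma exists_integral_truncPoissonChar_bounds {r B : ℝ} (hr : 0 < r) (hB : 0 < B) :
    ∃ c > 0, ∃ C > 0, ∃ N : ℕ, ∀ (n j : ℕ) (R m : ℝ), 0 < n → r * n ≤ j → j ≤ n →
      r ≤ R → R ≤ B → 0 ≤ m → m ≤ B → m ≤ 1 + R → R * exp R = m * (exp R - 1) →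
      (∫ θ in (-π)..π,
        (truncPoissonChar R θ * Complex.exp (-(m * (θ * Complex.I)))) ^ j).re ≤ C / √n ∧
      (N ≤ n → c / √n ≤ (∫ θ in (-π)..π,
        (truncPoissonChar R θ * Complex.exp (-(m * (θ * Complex.I)))) ^ j).re) := by
  obtain ⟨κ, hκ, hκ'⟩ := exists_norm_truncPoissonChar_le hr hB
  obtain ⟨C, hC, hC'⟩ := exists_norm_truncPoissonChar_sub_le hr hB
  set W := B * (1 + B) / 2 + κ * r with hW
  obtain ⟨N, hN⟩ := exists_le_integral_of_gaussian_approx (k := κ * r) (W := W) (by positivity)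
    (by rw [hW]; linarith [show 0 < B * (1 + B) / 2 by positivity]) hC
  refine ⟨exp (-W), exp_pos _, √(π / (κ * r)), by positivity, N,
    fun n j R m hn hj hjn h1 h2 hm hmB hmR hs => ?_⟩
  have hnr : (0 : ℝ) < n := by exact_mod_cast hn
  have hjn' : (j : ℝ) ≤ n := by exact_mod_cast hjn
  set f : ℝ → ℂ := fun θ => truncPoissonChar R θ * Complex.exp (-(m * (θ * Complex.I))) with hf
  have hfc : Continuous f := by
    have := continuous_truncPoissonChar R
    fun_prop
  have hfn : ∀ θ, |θ| ≤ π → ‖f θ‖ ≤ exp (-κ * θ ^ 2) := by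
    intro θ hθ
    have : -((m : ℂ) * (θ * Complex.I)) = ((-(m * θ) : ℝ) : ℂ) * Complex.I := by push_cast; ring
    rw [hf]
    dsimp only
    rw [norm_mul, this, Complex.norm_exp_ofReal_mul_I, mul_one]
    exact hκ' R θ h1 h2 hθ
  have hfj : ∀ θ, |θ| ≤ π → ‖f θ ^ j‖ ≤ exp (-(κ * r) * n * θ ^ 2) := by
    intro θ hθ
    rw [norm_pow]
    calc ‖f θ‖ ^ j ≤ exp (-κ * θ ^ 2) ^ j := by gcongr; exact hfn θ hθ
      _ = exp (-(κ * θ ^ 2 * j)) := by rw [← exp_nat_mul]; ring_nf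
      _ ≤ exp (-(κ * θ ^ 2 * (r * n))) := by gcongr
      _ = _ := by ring_nf
  have hre : (∫ θ in (-π)..π, f θ ^ j).re = ∫ θ in (-π)..π, (f θ ^ j).re :=
    (intervalIntegral.intervalIntegral_re ((hfc.pow j).intervalIntegrable _ _)).symm
  constructor
  · rw [hre]
    calc ∫ θ in (-π)..π, (f θ ^ j).re ≤ ∫ θ in (-π)..π, exp (-(κ * r * n) * θ ^ 2) := by
          refine intervalIntegral.integral_mono_on (by linarith [pi_pos])
            (Continuous.intervalIntegrable (by fun_prop) _ _)
            (Continuous.intervalIntegrable (by fun_prop) _ _) fun θ hθ => ?_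
          refine ((Complex.re_le_norm _).trans (hfj θ (abs_le.mpr hθ))).trans_eq ?_
          ring_nf
      _ ≤ √(π / (κ * r * n)) := integral_gaussian_Icc_le (by positivity)
      _ = _ := by rw [← div_div, sqrt_div (by positivity)]
  · intro hNn
    rw [hre]
    refine hN n hNn hn _ (by fun_prop) (fun θ hθ => ?_) fun θ hθ => ?_
    · exact (neg_le_neg (hfj θ hθ)).trans (neg_le_of_abs_le (Complex.abs_re_le_norm _))
    · have hv0 : 0 ≤ m * (1 + R - m) / 2 := by
        have : 0 ≤ 1 + R - m := by linarith
        positivity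
      have hvW : m * (1 + R - m) / 2 ≤ W := by
        have : m * (1 + R - m) ≤ B * (1 + B) := by gcongr; linarith
        have : 0 < κ * r := by positivity
        linarith
      set g : ℝ := exp (-(m * (1 + R - m) / 2 * θ ^ 2)) with hg
      have hg1 : ‖(g : ℂ)‖ ≤ 1 := by
        rw [Complex.norm_real, Real.norm_of_nonneg (exp_pos _).le, exp_le_one_iff]
        have : 0 ≤ m * (1 + R - m) / 2 * θ ^ 2 := by positivity
        linarith
      have hf1 : ‖f θ‖ ≤ 1 := by
        refine (hfn θ (hθ.trans (by linarith [pi_gt_three]))).trans (exp_le_one_iff.mpr ?_)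
        have : 0 ≤ κ * θ ^ 2 := by positivity
        linarith
      have h3 : ‖f θ ^ j - (g : ℂ) ^ j‖ ≤ C * n * |θ| ^ 3 := by
        calc _ ≤ j * ‖f θ - g‖ := norm_pow_sub_pow_le_mul hf1 hg1 j
          _ ≤ n * (C * |θ| ^ 3) := by
            gcongr
            exact hC' R m θ h1 h2 hm hmB hmR hs hθ
          _ = _ := by ring
      have h4 : exp (-W * n * θ ^ 2) ≤ g ^ j := by
        rw [hg, ← exp_nat_mul]
        apply exp_le_exp.mpr
        have : j * (m * (1 + R - m) / 2) * θ ^ 2 ≤ n * W * θ ^ 2 := by gcongr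
        linarith
      have h5 := (neg_le_of_abs_le (Complex.abs_re_le_norm (f θ ^ j - (g : ℂ) ^ j)))
      rw [Complex.sub_re, ← Complex.ofReal_pow, Complex.ofReal_re, Complex.ofReal_pow] at h5
      linarith

lemma factorial_le_stirling {n : ℕ} (hn : 0 < n) :
    (n.factorial : ℝ) ≤ exp 1 * √n * (n / exp 1) ^ n := by
  obtain ⟨k, rfl⟩ := Nat.exists_eq_add_one.mpr hn
  have h := Stirling.stirlingSeq'_antitone (Nat.zero_le k)
  simp only [Function.comp, Nat.succ_eq_add_one, zero_add, Stirling.stirlingSeq_one] at h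
  rw [Stirling.stirlingSeq, div_le_iff₀ (by positivity), sqrt_mul (by norm_num)] at h
  refine h.trans_eq ?_
  field_simp

lemma exists_pos_le_of_forall_mem_pos {ι : Type*} (s : Finset ι) (f : ι → ℝ)
    (hf : ∀ i ∈ s, 0 < f i) : ∃ c > 0, ∀ i ∈ s, c ≤ f i := by
  rcases s.eq_empty_or_nonempty with rfl | hs
  · exact ⟨1, one_pos, by simp⟩
  · obtain ⟨i, hi, h⟩ := s.exists_min_image f hs
    exact ⟨f i, hf i hi, h⟩

/-- The saddle point `R` attached to the ratio `x` lies in a compact subset of `(0, ∞)`. -/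
lemma saddle_point_bounds {r x d : ℝ} (hr : 0 < r) (hrx : r ≤ x) (hxr : x ≤ 1 - r)
    (hd : (1 + exp d) * log (1 + exp (-d)) = 1 / x) :
    r ≤ log (1 + exp (-d)) ∧ log (1 + exp (-d)) ≤ 1 / r ∧ 1 / x ≤ 1 / r ∧
      1 / x ≤ 1 + log (1 + exp (-d)) ∧
      log (1 + exp (-d)) * exp (log (1 + exp (-d))) =
        1 / x * (exp (log (1 + exp (-d))) - 1) := by
  have hx : 0 < x := hr.trans_le hrx
  have hexp : exp (log (1 + exp (-d))) = 1 + exp (-d) := exp_log (by positivity)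
  have hR : 0 < log (1 + exp (-d)) := log_pos (by linarith [exp_pos (-d)])
  set R := log (1 + exp (-d)) with hRd
  have hde : exp d * exp (-d) = 1 := by rw [← exp_add]; simp
  have hs : R * exp R = 1 / x * (exp R - 1) := by
    rw [← hd, hexp]
    linear_combination (-R) * hde
  have he : 0 < exp R - 1 := by linarith [add_one_le_exp R]
  have h1 : 1 / x ≤ 1 + R := by
    refine le_of_mul_le_mul_right ?_ he
    rw [← hs]
    linarith [add_one_le_exp R]
  have h2 : R ≤ 1 / x := by
    refine le_of_mul_le_mul_right ?_ he
    rw [← hs]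
    linarith
  have h3 : 1 / x ≤ 1 / r := one_div_le_one_div_of_le hr hrx
  have h4 : 1 + r ≤ 1 / x := by
    rw [le_div_iff₀ hx]
    nlinarith
  exact ⟨by linarith, h2.trans h3, h3, h1, hs⟩

lemma rpow_mul_psi_pow (δ : ℝ → ℝ) {n j : ℕ} (hn : 0 < n) (hj : 0 < j) :
    ((n : ℝ) ^ (1 - (j : ℝ) / n) * psi δ ((j : ℝ) / n)) ^ n =
      (n / exp 1) ^ n / (j / exp 1) ^ j *
        (exp (-δ ((j : ℝ) / n)) ^ j / log (1 + exp (-δ ((j : ℝ) / n))) ^ n) := by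
  have hn' : (0 : ℝ) < n := by exact_mod_cast hn
  have hj' : (0 : ℝ) < j := by exact_mod_cast hj
  rw [psi]
  set d := δ ((j : ℝ) / n)
  have h1 : ((n : ℝ) ^ (1 - (j : ℝ) / n)) ^ n = (n : ℝ) ^ n / (n : ℝ) ^ j := by
    rw [← rpow_mul_natCast hn'.le, sub_mul, one_mul, div_mul_cancel₀ _ hn'.ne', rpow_sub hn',
      rpow_natCast, rpow_natCast]
  have h2 : (((j : ℝ) / n) ^ ((j : ℝ) / n)) ^ n = (j : ℝ) ^ j / (n : ℝ) ^ j := by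
    rw [← rpow_mul_natCast (by positivity), div_mul_cancel₀ _ hn'.ne', rpow_natCast, div_pow]
  have h3 : exp (-((1 - (j : ℝ) / n) + (j : ℝ) / n * d)) ^ n =
      exp 1 ^ j / exp 1 ^ n * exp (-d) ^ j := by
    rw [← exp_nat_mul, ← exp_nat_mul, ← exp_nat_mul, ← exp_nat_mul, ← exp_sub, ← exp_add]
    congr 1
    field_simp
    ring
  rw [mul_pow, div_pow, mul_pow, h1, h2, h3, div_pow (n : ℝ), div_pow (j : ℝ)]
  field_simp

lemma stirling2_eq_integral {n j : ℕ} {R m : ℝ} (hR : 0 < R) (hm : j * m = n) :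
    stirling2 n j = (∫ θ in (-π)..π,
        (truncPoissonChar R θ * Complex.exp (-(m * (θ * Complex.I)))) ^ j).re *
      (n.factorial / j.factorial) * ((exp R - 1) ^ j / R ^ n) / (2 * π) := by
  have he : 0 < exp R - 1 := by linarith [add_one_le_exp R]
  have hmC : (j : ℂ) * m = n := by exact_mod_cast hm
  have h1 : ∀ θ : ℝ, (truncPoissonChar R θ * Complex.exp (-(m * (θ * Complex.I)))) ^ j =
      (((exp R - 1) ^ j)⁻¹ : ℝ) * ((Complex.exp (R * Complex.exp (θ * Complex.I)) - 1) ^ j *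
        Complex.exp (-(n * θ * Complex.I))) := by
    intro θ
    rw [truncPoissonChar, mul_pow, div_pow, ← Complex.exp_nat_mul, ← hmC]
    push_cast
    rw [mul_neg, ← mul_assoc, ← mul_assoc]
    ring
  simp_rw [h1]
  rw [intervalIntegral.integral_const_mul, integral_exp_sub_one_pow n j hR, ← Complex.ofReal_mul,
    Complex.ofReal_re]
  have := pi_pos
  field_simp


theorem stmt_19 (δ : ℝ → ℝ)
    (hδ : ∀ x ∈ Set.Ioo (0 : ℝ) 1,
      (1 + Real.exp (δ x)) * Real.log (1 + Real.exp (-(δ x))) = 1 / x)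
    (r : ℝ) (hr0 : 0 < r) (hr1 : r < 1 / 2) :
    ∃ c1 C1 : ℝ, 0 < c1 ∧ 0 < C1 ∧
      ∀ n j : ℕ, 0 < n → 0 < j → r ≤ (j : ℝ) / n → (j : ℝ) / n ≤ 1 - r →
        Real.exp (-(1 / 12)) * c1 / Real.sqrt (2 * Real.pi * n) *
            ((n : ℝ) ^ (1 - (j : ℝ) / n) * psi δ ((j : ℝ) / n)) ^ n ≤ stirling2 n j ∧
        stirling2 n j ≤ Real.exp (1 / 12) * C1 / Real.sqrt (2 * Real.pi * n) *
            ((n : ℝ) ^ (1 - (j : ℝ) / n) * psi δ ((j : ℝ) / n)) ^ n := by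
  obtain ⟨c, hc, C, hC, N, hN⟩ :=
    exists_integral_truncPoissonChar_bounds hr0 (B := 1 / r) (by positivity)
  set M : ℕ → ℕ → ℝ := fun n j => ((n : ℝ) ^ (1 - (j : ℝ) / n) * psi δ ((j : ℝ) / n)) ^ n with hM
  have hMpos : ∀ n j : ℕ, 0 < n → 0 < j → 0 < M n j := by
    intro n j hn hj
    have hlog : 0 < log (1 + exp (-δ ((j : ℝ) / n))) := log_pos (by linarith [exp_pos (-δ (j / n))])
    rw [hM]
    dsimp only
    rw [rpow_mul_psi_pow δ hn hj]
    positivity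
  obtain ⟨c', hc', hsmall⟩ := exists_pos_le_of_forall_mem_pos
    ((range N ×ˢ range N).filter fun p => 0 < p.2 ∧ p.2 ≤ p.1)
    (fun p => stirling2 p.1 p.2 / (M p.1 p.2 / √(2 * π * p.1))) (by
      rintro ⟨n, j⟩ h
      obtain ⟨-, hj, hjn⟩ := mem_filter.mp h
      have h1 := stirling2_pos hj hjn
      have h2 := hMpos n j (hj.trans_le hjn) hj
      have h3 : (0 : ℝ) < n := by exact_mod_cast hj.trans_le hjn
      positivity)
  refine ⟨exp (1 / 12) * min c' (c / exp 1), exp (-(1 / 12)) * (C * exp 1 / (2 * π * √r)),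
    by positivity, by positivity, fun n j hn hj hrx hxr => ?_⟩
  have hn' : (0 : ℝ) < n := by exact_mod_cast hn
  have hj' : (0 : ℝ) < j := by exact_mod_cast hj
  have hrn : r * n ≤ j := (le_div_iff₀ hn').mp hrx
  have hjn' : (j : ℝ) ≤ n := by
    rw [div_le_iff₀ hn'] at hxr
    nlinarith
  have hjn : j ≤ n := by exact_mod_cast hjn'
  have hMp := hMpos n j hn hj
  change _ * M n j ≤ _ ∧ _ ≤ _ * M n j
  rw [← mul_assoc, ← mul_assoc, ← exp_add, ← exp_add, neg_add_cancel, add_neg_cancel, exp_zero,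
    one_mul, one_mul]
  obtain ⟨b1, b2, b3, b4, b5⟩ :=
    saddle_point_bounds hr0 hrx hxr (hδ _ ⟨by positivity, by linarith⟩)
  have hexpR : exp (-δ ((j : ℝ) / n)) = exp (log (1 + exp (-δ ((j : ℝ) / n)))) - 1 := by
    rw [exp_log (by positivity)]; ring
  have hMeq : M n j = _ := rpow_mul_psi_pow δ hn hj
  rw [hexpR] at hMeq
  rw [exp_log (by positivity : 0 < 1 + exp (-δ ((j : ℝ) / n))), add_sub_cancel_left] at hMeq
  set R := log (1 + exp (-δ ((j : ℝ) / n))) with hR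
  rw [hexpR] at hMeq
  have hRpos : 0 < R := hr0.trans_le b1
  have he : 0 < exp R - 1 := by linarith [add_one_le_exp R]
  have hmj : (j : ℝ) * (1 / ((j : ℝ) / n)) = n := by field_simp
  have hS := stirling2_eq_integral (n := n) hRpos hmj
  obtain ⟨up, low⟩ := hN n j R _ hn hrn hjn b1 b2 (by positivity) b3 b4 b5
  set J := (∫ θ in (-π)..π,
    (truncPoissonChar R θ * Complex.exp (-((1 / ((j : ℝ) / n) : ℝ) * (θ * Complex.I)))) ^ j).re
  set Q := (exp R - 1) ^ j / R ^ n with hQ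
  have hQ0 : 0 < Q := by positivity
  set a := ((n : ℝ) / exp 1) ^ n
  set b := ((j : ℝ) / exp 1) ^ j with hb
  have ha0 : 0 < a := by positivity
  have hb0 : 0 < b := by positivity
  have hfn1 := Stirling.le_factorial_stirling n
  have hfn2 := factorial_le_stirling hn
  have hfj1 := Stirling.le_factorial_stirling j
  have hfj2 := factorial_le_stirling hj
  have hpi := pi_pos
  constructor
  · by_cases hnN : N ≤ n
    · have h1 : √(2 * π * n) * a / (exp 1 * √n * b) ≤ n.factorial / j.factorial := by
        gcongr
        refine hfj2.trans ?_
        gcongr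
      calc min c' (c / exp 1) / √(2 * π * n) * M n j
          ≤ c / exp 1 / √(2 * π * n) * M n j := by gcongr; exact min_le_right _ _
        _ = c / √n * (√(2 * π * n) * a / (exp 1 * √n * b)) * Q / (2 * π) := by
          rw [hMeq]
          have e1 : √(2 * π * n) ^ 2 = 2 * π * n := sq_sqrt (by positivity)
          have e2 : √(n : ℝ) ^ 2 = n := sq_sqrt hn'.le
          field_simp
          rw [e1, e2]
        _ ≤ J * (n.factorial / j.factorial) * Q / (2 * π) := by
          have := low hnN
          have hJ : 0 ≤ J := le_trans (by positivity) this
          gcongr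
        _ = _ := hS.symm
    · have h1 := hsmall (n, j) (by
        simp only [mem_filter, mem_product, mem_range]
        omega)
      dsimp only at h1
      rw [le_div_iff₀ (by positivity)] at h1
      calc min c' (c / exp 1) / √(2 * π * n) * M n j ≤ c' / √(2 * π * n) * M n j := by
            gcongr; exact min_le_left _ _
        _ = c' * (M n j / √(2 * π * n)) := by ring
        _ ≤ _ := h1
  · have h1 : (n.factorial : ℝ) / j.factorial ≤ exp 1 * √n * a / (√(2 * π * (r * n)) * b) := by
      gcongr
      refine le_trans ?_ hfj1
      gcongr
    calc stirling2 n j = J * (n.factorial / j.factorial) * Q / (2 * π) := hS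
      _ ≤ C / √n * (exp 1 * √n * a / (√(2 * π * (r * n)) * b)) * Q / (2 * π) := by gcongr
      _ = _ := by
        rw [hMeq, show 2 * π * (r * n) = r * (2 * π * n) by ring, sqrt_mul hr0.le]
        field_simp
end
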